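/- Milliken's vector tree theorem: let T = (T_1, …, T_d) be a vector tree such that each T_i is nonempty, rooted, balanced, finitely branching and of infinite height. Then for every k ∈ ℕ and every colouring of Str_k(T) with finitely many colours, there exists S ∈ Str_ω(T) such that the set Str_k(S) (whose members are also vector strong subtrees of T) is monochromatic. -/

import Mathlib

open scoped Classical

section AbstractTrees

variable {α : Type*} [PartialOrder α]

/-- The set of strict predecessors of `t` inside `U`. -/
def predsIn (U : Set α) (t : α) : Set α := {s ∈ U | s < t}

/-- The level of a node `t` in the tree `U`: the number of its strict predecessors in `U`. -/
noncomputable def levelIn (U : Set α) (t : α) : ℕ := (predsIn U t).ncard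

/-- `U` is a tree: the set of strict predecessors of every node is finite and
linearly ordered. -/
def IsTreeOn (U : Set α) : Prop :=
  ∀ t ∈ U, (predsIn U t).Finite ∧
    ∀ s₁ ∈ predsIn U t, ∀ s₂ ∈ predsIn U t, s₁ ≤ s₂ ∨ s₂ ≤ s₁

/-- The height of the tree `U`: the least `n` such that `U` has no node of level `n`
(equivalently, for trees, the supremum of `level + 1`), or `ω = ⊤` if there is no such `n`. -/
noncomputable def heightIn (U : Set α) : ℕ∞ :=
  ⨆ t ∈ U, ((levelIn U t : ℕ∞) + 1)

/-- The level set `L_U(D)` of `D` in `U`. -/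
def levelSetIn (U D : Set α) : Set ℕ := levelIn U '' D

/-- `t` is a maximal node of `U`. -/
def IsMaximalIn (U : Set α) (t : α) : Prop := t ∈ U ∧ ∀ s ∈ U, ¬ t < s

/-- `U` is rooted: it has a unique minimal element below all of its nodes. -/
def IsRootedIn (U : Set α) : Prop := ∃ r ∈ U, ∀ t ∈ U, r ≤ t

/-- `U` is balanced: either it has infinite height and no maximal nodes, or all its
maximal nodes lie on level `h(U) - 1`. -/
def IsBalanced (U : Set α) : Prop :=
  (heightIn U = ⊤ ∧ ∀ t, ¬ IsMaximalIn U t) ∨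
  (heightIn U ≠ ⊤ ∧ ∀ t, IsMaximalIn U t → ((levelIn U t : ℕ∞) + 1 = heightIn U))

/-- `m` is the meet `s ∧_U t` of `s` and `t` in `U`. -/
def IsMeetIn (U : Set α) (s t m : α) : Prop :=
  m ∈ U ∧ m ≤ s ∧ m ≤ t ∧ ∀ m' ∈ U, m' ≤ s → m' ≤ t → m' ≤ m

/-- `S` is a subtree of `U`: a subset closed under binary meets (taken in `U`). -/
def IsSubtreeOf (U S : Set α) : Prop :=
  S ⊆ U ∧ ∀ s ∈ S, ∀ t ∈ S, ∃ m ∈ S, IsMeetIn U s t m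

/-- `t` is an immediate successor of `s` in `U`. -/
def IsImmSuccIn (U : Set α) (s t : α) : Prop :=
  s ∈ U ∧ t ∈ U ∧ s < t ∧ ∀ u ∈ U, s < u → ¬ u < t

/-- `U` is finitely branching. -/
def IsFinBranching (U : Set α) : Prop :=
  ∀ t ∈ U, {s | IsImmSuccIn U t s}.Finite

/-- `S` is a strong subtree of `U`: it is a subtree which is either empty, or is
rooted, balanced, has each of its levels contained in a single level of `U`, and for every
non-maximal node `s ∈ S` and every immediate successor `t` of `s` in `U` there is exactly
one immediate successor of `s` in `S` above `t`. -/
def IsStrongSubtreeOf (U S : Set α) : Prop :=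
  IsSubtreeOf U S ∧
  (S = ∅ ∨
    (IsRootedIn S ∧ IsBalanced S ∧
      (∀ s ∈ S, ∀ t ∈ S, levelIn S s = levelIn S t → levelIn U s = levelIn U t) ∧
      (∀ s ∈ S, ¬ IsMaximalIn S s → ∀ t, IsImmSuccIn U s t →
        ∃! c, IsImmSuccIn S s c ∧ t ≤ c)))

end AbstractTrees

/-- Given colourings `κ m a` of `Ω`, there is a family of promises `(B, a, c)`, densely many for
each `a`, such that any finite set of promises about `B` is kept at a point of `B` by
arbitrarily large `m`. -/
theorem exists_deciding_family {Ω I C : Type*} [Finite C] (𝓑 : Set (Set Ω))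
    (hne : ∀ B ∈ 𝓑, B.Nonempty) (κ : ℕ → I → Ω → C) :
    ∃ 𝒢 : Set (Set Ω × I × C),
      (∀ J : Finset (Set Ω × I × C), ↑J ⊆ 𝒢 → ∀ B ∈ 𝓑, (∀ g ∈ J, B ⊆ g.1) →
        ∀ M, ∃ m ≥ M, ∃ y ∈ B, ∀ g ∈ J, κ m g.2.1 y = g.2.2) ∧
      ∀ a, ∀ B ∈ 𝓑, ∃ B' ∈ 𝓑, B' ⊆ B ∧ ∃ c, (B', a, c) ∈ 𝒢 := by
  let Cons : Set (Set Ω × I × C) → Prop := fun 𝒢 =>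
    ∀ J : Finset (Set Ω × I × C), ↑J ⊆ 𝒢 → ∀ B ∈ 𝓑, (∀ g ∈ J, B ⊆ g.1) →
        ∀ M, ∃ m ≥ M, ∃ y ∈ B, ∀ g ∈ J, κ m g.2.1 y = g.2.2
  obtain ⟨𝒢, h𝒢, hmax⟩ : ∃ 𝒢, Cons 𝒢 ∧ ∀ ℋ, Cons ℋ → 𝒢 ⊆ ℋ → ℋ = 𝒢 := by
    obtain ⟨𝒢, _, h⟩ := zorn_subset_nonempty {𝒢 | Cons 𝒢} (fun c hc hch hcne => by
      refine ⟨⋃₀ c, ?_, fun s hs => Set.subset_sUnion_of_mem hs⟩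
      intro J hJ
      obtain ⟨s, hs, hJs⟩ : ∃ s ∈ c, ↑J ⊆ s :=
        DirectedOn.exists_mem_subset_of_finset_subset_biUnion (f := id) hcne
          hch.directedOn (by simpa [Set.sUnion_eq_biUnion] using hJ)
      exact hc hs J hJs) ∅ (by
        intro J hJ B hB _ M
        obtain ⟨y, hy⟩ := hne B hB
        refine ⟨M, le_rfl, y, hy, fun g hg => ?_⟩
        exact absurd (hJ hg) (by simp))
    exact ⟨𝒢, h.prop, fun ℋ hℋ hle => (h.eq_of_subset hℋ hle).symm⟩
  refine ⟨𝒢, h𝒢, fun a B hB => ?_⟩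
  by_contra hcon
  push Not at hcon
  have step : ∀ D : Finset C, ∃ B' ∈ 𝓑, B' ⊆ B ∧ ∃ J : Finset (Set Ω × I × C), ↑J ⊆ 𝒢 ∧
      (∀ g ∈ J, B' ⊆ g.1) ∧ ∃ M, ∀ m ≥ M, ∀ y ∈ B',
        (∀ g ∈ J, κ m g.2.1 y = g.2.2) → κ m a y ∉ D := by
    intro D
    induction D using Finset.induction_on with
    | empty => exact ⟨B, hB, subset_rfl, ∅, by simp, by simp, 0, by simp⟩
    | insert c D _ ih =>
      obtain ⟨B₁, hB₁, hB₁B, J, hJ, hJB, M, hM⟩ := ih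
      have hnot : ¬ Cons (insert (B₁, a, c) 𝒢) := by
        intro h
        have := hmax _ h (Set.subset_insert _ _)
        exact hcon B₁ hB₁ hB₁B c (this ▸ Set.mem_insert _ _)
      simp only [Cons] at hnot
      push Not at hnot
      obtain ⟨K, hK, B₂, hB₂, hB₂K, M₂, hM₂⟩ := hnot
      have hmem : (B₁, a, c) ∈ K := by
        by_contra hn
        have hK' : ↑K ⊆ 𝒢 := fun g hg => (hK hg).resolve_left (by rintro rfl; exact hn hg)
        obtain ⟨m, hm, y, hy, h⟩ := h𝒢 K hK' B₂ hB₂ hB₂K M₂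
        obtain ⟨g, hg, hne⟩ := hM₂ m hm y hy
        exact hne (h g hg)
      have h21 : B₂ ⊆ B₁ := hB₂K _ hmem
      refine ⟨B₂, hB₂, h21.trans hB₁B, J ∪ K.erase (B₁, a, c), ?_, ?_, max M M₂, ?_⟩
      · intro g hg
        simp only [Finset.coe_union, Finset.coe_erase, Set.mem_union] at hg
        rcases hg with hg | hg
        · exact hJ hg
        · exact (hK hg.1).resolve_left hg.2
      · intro g hg
        rcases Finset.mem_union.1 hg with hg | hg
        · exact h21.trans (hJB g hg)
        · exact hB₂K g (Finset.mem_of_mem_erase hg)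
      · intro m hm y hy hg
        have h1 := hM m (le_trans (le_max_left _ _) hm) y (h21 hy)
          fun g h => hg g (Finset.mem_union_left _ h)
        obtain ⟨g, hgK, hgne⟩ := hM₂ m (le_trans (le_max_right _ _) hm) y hy
        have hgeq : g = (B₁, a, c) := by
          by_contra hn
          exact hgne (hg g (Finset.mem_union_right _ (Finset.mem_erase.2 ⟨hn, hgK⟩)))
        subst hgeq
        simpa [h1] using hgne
  have := Fintype.ofFinite C
  obtain ⟨B', hB', _, J, hJ, hJB, M, hM⟩ := step Finset.univ
  obtain ⟨m, hm, y, hy, h⟩ := h𝒢 J hJ B' hB' hJB M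
  exact hM m hm y hy h (Finset.mem_univ _)

theorem exists_pi_comp_symm_eq {J J' : Type*} (e : J ≃ J') {K : J → Type*}
    (a : ∀ j, K (e.symm j)) : ∃ b : ∀ j, K j, a = fun j => b (e.symm j) :=
  ⟨Equiv.piCongrLeft K e.symm a, funext fun j =>
    (Equiv.piCongrLeft_apply_apply K e.symm a j).symm⟩

/-- A polarized pigeonhole principle: there are index sets `K j` so large that every
colouring of `∏ K j` with colours in `Q` is constant on a box of sizes prescribed by the colour. -/
theorem exists_polarized_pigeonhole (J : Type) [Finite J] (Q : Type) :
    ∃ K : J → Type, ∀ (g : (∀ j, K j) → Q) (M : Q → J → ℕ),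
      ∃ q, ∃ H : ∀ j, Finset (K j), (∀ j, (H j).card = M q j) ∧
        ∀ a : ∀ j, K j, (∀ j, a j ∈ H j) → g a = q := by
  induction J using Finite.induction_empty_option with
  | @of_equiv J J' e ih =>
    obtain ⟨K, hK⟩ := ih
    refine ⟨fun j => K (e.symm j), fun g M => ?_⟩
    obtain ⟨q, H, hH, hg⟩ := hK (fun a => g fun j => a (e.symm j)) (fun q j => M q (e j))
    refine ⟨q, fun j => H (e.symm j), fun j => by simp [hH], fun a ha => ?_⟩
    obtain ⟨b, rfl⟩ := exists_pi_comp_symm_eq e a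
    refine hg b fun j => ?_
    obtain ⟨i, rfl⟩ := e.symm.surjective j
    exact ha i
  | h_empty =>
    refine ⟨fun _ => ℕ, fun g M => ⟨g (fun j => j.elim), fun j => j.elim, fun j => j.elim, ?_⟩⟩
    intro a _
    congr 1
    funext j
    exact j.elim
  | @h_option J _ ih =>
    obtain ⟨K, hK⟩ := ih
    let L := ℕ × Q × (∀ j, Finset (K j))
    refine ⟨fun o => o.elim (Set L) K, fun g M => ?_⟩
    let glue : (∀ j, K j) → Set L → ∀ o : Option J, o.elim (Set L) K := fun a h o =>
      match o with
      | none => h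
      | some j => a j
    have hsel : ∀ h : Set L, ∃ p : Q × (∀ j, Finset (K j)),
        (∀ j, (p.2 j).card = M p.1 (some j)) ∧
          ∀ a : ∀ j, K j, (∀ j, a j ∈ p.2 j) → g (glue a h) = p.1 := fun h => by
      obtain ⟨q, H, h1, h2⟩ := hK (fun a => g (glue a h)) (fun q j => M q (some j))
      exact ⟨(q, H), h1, h2⟩
    choose P hP using hsel
    obtain ⟨p, hp⟩ : ∃ p : L, Infinite ((fun h => ((0 : ℕ), P h)) ⁻¹' {p}) := by
      have : Nonempty (Q × (∀ j, Finset (K j))) := ⟨P ∅⟩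
      have : Infinite L := inferInstanceAs (Infinite (ℕ × (Q × (∀ j, Finset (K j)))))
      exact Cardinal.exists_infinite_fiber' _ (by rw [Cardinal.mk_set]; exact Cardinal.cantor _)
    obtain ⟨n, q, H⟩ := p
    obtain ⟨F, hF, hFc⟩ := Set.Infinite.exists_subset_card_eq (Set.infinite_coe_iff.1 hp) (M q none)
    have hmem : ∀ h ∈ F, P h = (q, H) := fun h hh => by
      have := hF hh
      simp only [Set.mem_preimage, Set.mem_singleton_iff, Prod.mk.injEq] at this
      exact this.2
    refine ⟨q, fun o => match o with
      | none => F
      | some j => H j, ?_, ?_⟩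
    · rintro (_ | j)
      · exact hFc
      · obtain ⟨h0⟩ : Nonempty ((fun h => ((0 : ℕ), P h)) ⁻¹' {(n, q, H)}) := inferInstance
        have : P h0 = (q, H) := by
          have := h0.2
          simp only [Set.mem_preimage, Set.mem_singleton_iff, Prod.mk.injEq] at this
          exact this.2
        have h1 := (hP h0).1 j
        rw [this] at h1
        exact h1
    · intro a ha
      have h1 := (hP (a none)).2 (fun j => a (some j))
      rw [hmem _ (ha none)] at h1
      refine Eq.trans ?_ (h1 fun j => ha (some j))
      congr 1
      funext o
      cases o <;> rfl

/-- A subset of positive density of a sufficiently large finite box contains a box of size `N`. -/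
theorem exists_box_of_dense (J : Type) [Finite J] (s N : ℕ) (hs : 0 < s) (hN : 0 < N) :
    ∃ M : J → ℕ, ∀ [Fintype J] (K : J → Type) (H : ∀ j, Finset (K j)),
      (∀ j, (H j).card = M j) → ∀ P : (∀ j, K j) → Prop,
      ∏ j, M j ≤ s * ((Fintype.piFinset H).filter P).card →
      ∃ H' : ∀ j, Finset (K j), (∀ j, H' j ⊆ H j) ∧ (∀ j, N ≤ (H' j).card) ∧
        ∀ a : ∀ j, K j, (∀ j, a j ∈ H' j) → P a := by
  induction J using Finite.induction_empty_option generalizing s with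
  | @of_equiv J J' e ih =>
    obtain ⟨M, hM⟩ := ih s hs
    refine ⟨fun j => M (e.symm j), fun {_} K H hH P hP => ?_⟩
    have := Fintype.ofEquiv J' e.symm
    obtain ⟨H', h1, h2, h3⟩ := hM (fun j => K (e j)) (fun j => H (e j))
      (fun j => by simp [hH]) (fun a => ∃ b : ∀ j, K j, (a = fun j => b (e j)) ∧ P b) (by
        rw [← Equiv.prod_comp e.symm]
        refine hP.trans (Nat.mul_le_mul_left _ ?_)
        refine Finset.card_le_card_of_injOn (fun b j => b (e j)) ?_ ?_
        · intro b hb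
          simp only [Finset.coe_filter, Fintype.mem_piFinset, Set.mem_ofPred_eq] at hb ⊢
          exact ⟨fun j => hb.1 _, b, rfl, hb.2⟩
        · intro b _ b' _ h
          funext j
          obtain ⟨i, rfl⟩ := e.surjective j
          exact congrFun h i)
    obtain ⟨H'', rfl⟩ := exists_pi_comp_symm_eq (K := fun j => Finset (K j)) e.symm H'
    refine ⟨H'', fun j => ?_, fun j => ?_, fun a ha => ?_⟩
    · obtain ⟨i, rfl⟩ := e.surjective j
      exact h1 i
    · obtain ⟨i, rfl⟩ := e.surjective j
      exact h2 i
    · obtain ⟨b, hb, hPb⟩ := h3 (fun j => a (e j)) (fun j => ha (e j))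
      have : a = b := by
        funext j
        obtain ⟨i, rfl⟩ := e.surjective j
        exact congrFun hb i
      exact this ▸ hPb
  | h_empty =>
    refine ⟨fun _ => 0, fun {_} K H hH P hP => ⟨fun j => j.elim, fun j => j.elim,
      fun j => j.elim, fun a _ => ?_⟩⟩
    simp only [Finset.univ_eq_empty, Finset.prod_empty] at hP
    obtain ⟨b, hb⟩ := Finset.card_pos.1 (Nat.pos_of_mul_pos_left (lt_of_lt_of_le one_pos hP))
    rw [Subsingleton.elim a b]
    exact (Finset.mem_filter.1 hb).2
  | @h_option J _ ih =>
    obtain ⟨M, hM⟩ := ih (2 * s) (by omega)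
    obtain ⟨a, ha⟩ : ∃ a, a = ∏ j, M j := ⟨_, rfl⟩
    refine ⟨fun o => o.elim (2 * s * (2 ^ a * N)) M, fun {inst} K H hH P hP => ?_⟩
    obtain rfl : inst = instFintypeOption := Subsingleton.elim _ _
    let glue : (∀ j, K (some j)) → K none → ∀ o, K o := fun b h o =>
      match o with
      | none => h
      | some j => b j
    have hglue : ∀ b : ∀ o, K o, glue (fun j => b (some j)) (b none) = b := fun b => by
      funext o
      cases o <;> rfl
    let HJ : ∀ j, Finset (K (some j)) := fun j => H (some j)
    let f : K none → Finset (∀ j, K (some j)) := fun h =>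
      (Fintype.piFinset HJ).filter fun b => P (glue b h)
    have hHJ : (Fintype.piFinset HJ).card = a := by
      rw [Fintype.card_piFinset, ha]
      exact Finset.prod_congr rfl fun j _ => hH (some j)
    have hn : (H none).card = 2 * s * (2 ^ a * N) := hH none
    have hfa : ∀ h, (f h).card ≤ a := fun h => hHJ ▸ Finset.card_filter_le _ _
    have hsum : ((Fintype.piFinset H).filter P).card ≤ ∑ h ∈ H none, (f h).card := by
      rw [Finset.card_eq_sum_card_fiberwise (f := fun b => b none) (t := H none)]
      · refine Finset.sum_le_sum fun h _ => ?_
        refine Finset.card_le_card_of_injOn (fun b j => b (some j)) ?_ ?_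
        · intro b hb
          simp only [Finset.coe_filter, Fintype.mem_piFinset, Set.mem_ofPred_eq,
            Finset.mem_filter, f] at hb ⊢
          refine ⟨fun j => hb.1.1 _, ?_⟩
          rw [← hb.2, hglue]
          exact hb.1.2
        · intro b hb b' hb' h
          simp only [Finset.coe_filter, Set.mem_ofPred_eq] at hb hb'
          rw [← hglue b, ← hglue b', hb.2, hb'.2]
          exact congrArg (glue · _) h
      · intro b hb
        simp only [Finset.coe_filter, Fintype.mem_piFinset, Set.mem_ofPred_eq] at hb
        exact hb.1 none
    let G := (H none).filter fun h => a ≤ 2 * s * (f h).card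
    have hG : 2 ^ a * N ≤ G.card := by
      rcases Nat.eq_zero_or_pos a with h0 | h0
      · have : G = H none := Finset.filter_true_of_mem fun h _ => by omega
        rw [this, hn]
        exact Nat.le_mul_of_pos_left _ (by omega)
      · have h1 : 2 * s * ∑ h ∈ H none, (f h).card ≤
            2 * s * (G.card * a) + (H none).card * a := by
          rw [← Finset.sum_filter_add_sum_filter_not (H none)
            (fun h => a ≤ 2 * s * (f h).card), mul_add]
          refine Nat.add_le_add (Nat.mul_le_mul_left _ ?_) ?_
          · exact (Finset.sum_le_card_nsmul _ _ a fun h _ => hfa h)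
          · rw [Finset.mul_sum]
            refine (Finset.sum_le_card_nsmul _ _ a fun h hh => ?_).trans ?_
            · exact (not_le.1 (Finset.mem_filter.1 hh).2).le
            · exact Nat.mul_le_mul_right _ (Finset.card_filter_le _ _)
        rw [Fintype.prod_option] at hP
        simp only [Option.elim] at hP
        rw [← ha] at hP
        have h2 := hP.trans (Nat.mul_le_mul_left s (le_trans (by convert le_rfl) hsum))
        rw [hn] at h1
        have h3 : 2 * s * a * (2 ^ a * N) ≤ 2 * s * a * G.card := by nlinarith
        exact Nat.le_of_mul_le_mul_left h3 (by positivity)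
    obtain ⟨y, hy, hyc⟩ := Finset.exists_le_card_fiber_of_mul_le_card_of_maps_to
      (s := G) (t := (Fintype.piFinset HJ).powerset) (f := f) (n := N)
      (fun h _ => Finset.mem_powerset.2 (Finset.filter_subset _ _)) ⟨∅, by simp⟩
      (by rw [Finset.card_powerset, hHJ]; exact hG)
    obtain ⟨h0, hh0⟩ := Finset.card_pos.1 (lt_of_lt_of_le hN hyc)
    rw [Finset.mem_filter] at hh0
    obtain ⟨H', h1, h2, h3⟩ := hM (fun j => K (some j)) HJ (fun j => hH (some j))
      (fun b => P (glue b h0)) (by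
        rw [← ha]
        exact (Finset.mem_filter.1 hh0.1).2)
    refine ⟨fun o => match o with
      | none => G.filter fun h => f h = y
      | some j => H' j, ?_, ?_, ?_⟩
    · rintro (_ | j)
      · exact (Finset.filter_subset _ _).trans (Finset.filter_subset _ _)
      · exact h1 j
    · rintro (_ | j)
      · exact hyc
      · exact h2 j
    · intro b hb
      have hb0 : f (b none) = y := (Finset.mem_filter.1 (hb none)).2
      have : (fun j => b (some j)) ∈ f (b none) := by
        rw [hb0, ← hh0.2]
        exact Finset.mem_filter.2 ⟨Fintype.mem_piFinset.2 fun j => h1 j (hb (some j)),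
          h3 _ fun j => hb (some j)⟩
      have := (Finset.mem_filter.1 this).2
      rwa [hglue] at this

/-- Among partial assignments of at most `s` variables with at most `v` values, a proportion of at
least `v ^ (-s)` is extended by a single total assignment. -/
theorem exists_assignment_of_partial {E I : Type*} {W : E → Type*} [∀ e, Fintype (W e)]
    [∀ e, Nonempty (W e)] (v s : ℕ) (hv : 0 < v) (hW : ∀ e, Fintype.card (W e) ≤ v)
    (A : Finset I) (F : I → Finset E) (hF : ∀ i ∈ A, (F i).card ≤ s) (x : I → ∀ e, W e) :
    ∃ y : ∀ e, W e, A.card ≤ v ^ s * (A.filter fun i => ∀ e ∈ F i, y e = x i e).card := by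
  let E' := A.biUnion F
  let Z := ∀ e : E', W e
  let m : I → Finset Z := fun i => Finset.univ.filter fun z => ∀ e : E', ↑e ∈ F i → z e = x i e
  have hm : ∀ i ∈ A, Fintype.card Z ≤ v ^ s * (m i).card := by
    intro i hi
    have hinj : Function.Injective (fun z : Z =>
        ((⟨fun e => if ↑e ∈ F i then x i e else z e, by
          simp only [m, Finset.mem_filter, Finset.mem_univ, true_and]
          intro e he
          simp [he]⟩ : m i),
        (fun e : F i => z ⟨e, Finset.mem_biUnion.2 ⟨i, hi, e.2⟩⟩))) := by
      intro z z' h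
      simp only [Prod.mk.injEq, Subtype.mk.injEq] at h
      funext e
      by_cases he : ↑e ∈ F i
      · exact congrFun h.2 ⟨e, he⟩
      · simpa [he] using congrFun h.1 e
    have := Fintype.card_le_of_injective _ hinj
    rw [Fintype.card_prod, Fintype.card_coe, mul_comm] at this
    refine this.trans (Nat.mul_le_mul_right _ ?_)
    rw [Fintype.card_pi]
    refine (Finset.prod_le_pow_card _ _ v fun e _ => hW _).trans ?_
    exact Nat.pow_le_pow_right hv (by simpa using hF i hi)
  have hsum : ∑ _z : Z, A.card ≤
      ∑ z : Z, v ^ s * (A.filter fun i => z ∈ m i).card := by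
    rw [← Finset.mul_sum]
    have : ∑ z : Z, (A.filter fun i => z ∈ m i).card = ∑ i ∈ A, (m i).card := by
      have := Finset.sum_card_bipartiteAbove_eq_sum_card_bipartiteBelow
        (s := A) (t := (Finset.univ : Finset Z)) (fun i z => z ∈ m i)
      simp only [Finset.bipartiteAbove, Finset.bipartiteBelow] at this
      rw [← this]
      refine Finset.sum_congr rfl fun i _ => ?_
      simp
    rw [this, Finset.mul_sum, Finset.sum_const, Finset.card_univ, smul_eq_mul, mul_comm,
      ← smul_eq_mul, ← Finset.sum_const]
    exact Finset.sum_le_sum hm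
  obtain ⟨z, _, hz⟩ := Finset.exists_le_of_sum_le Finset.univ_nonempty hsum
  refine ⟨fun e => if h : e ∈ E' then z ⟨e, h⟩ else Classical.arbitrary _, hz.trans ?_⟩
  refine Nat.mul_le_mul_left _ (Finset.card_le_card ?_)
  intro i hi
  rw [Finset.mem_filter] at hi ⊢
  refine ⟨hi.1, fun e he => ?_⟩
  have hE : e ∈ E' := Finset.mem_biUnion.2 ⟨i, hi.1, he⟩
  have := hi.2
  simp only [m, Finset.mem_filter, Finset.mem_univ, true_and] at this
  simpa [hE] using this ⟨e, hE⟩ he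

/-- The Halpern–Läuchli theorem in dense form, for refining sequences of finite-range maps. -/
theorem exists_dense_monochromatic (J : Type) [Finite J] (X V : J → Type) [∀ j, Nonempty (X j)]
    (π : ∀ j, ℕ → X j → V j) (hfin : ∀ j n, (Set.range (π j n)).Finite)
    (hπ : ∀ j n x y, π j (n + 1) x = π j (n + 1) y → π j n x = π j n y)
    {C : Type} [Finite C] (κ : (∀ j, V j) → C) :
    ∃ (l : ℕ) (t : ∀ j, V j) (c : C), (∃ x : ∀ j, X j, ∀ j, π j l (x j) = t j) ∧
      ∀ n, ∃ m ≥ n, ∃ ψ : ∀ j, V j → X j,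
        (∀ j y, π j l y = t j → π j n (ψ j (π j n y)) = π j n y) ∧
        ∀ y : ∀ j, X j, (∀ j, π j l (y j) = t j) →
          κ (fun j => π j m (ψ j (π j n (y j)))) = c := by
  have := Fintype.ofFinite J
  have hπle : ∀ j m n, m ≤ n → ∀ x y, π j n x = π j n y → π j m x = π j m y := by
    intro j m n hmn x y
    induction n, hmn using Nat.le_induction with
    | base => exact id
    | succ n _ ih => exact fun h => ih (hπ j n x y h)
  by_contra hcon
  push Not at hcon
  have hbad : ∀ q : ℕ × ℕ × (∀ j, V j) × C, ∃ n,
      (∃ x : ∀ j, X j, ∀ j, π j q.1 (x j) = q.2.2.1 j) → ∀ m ≥ n, ∀ ψ : ∀ j, V j → X j,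
        (∀ j y, π j q.1 y = q.2.2.1 j → π j n (ψ j (π j n y)) = π j n y) →
        ∃ y : ∀ j, X j, (∀ j, π j q.1 (y j) = q.2.2.1 j) ∧
          κ (fun j => π j m (ψ j (π j n (y j)))) ≠ q.2.2.2 := by
    intro q
    by_cases h : ∃ x : ∀ j, X j, ∀ j, π j q.1 (x j) = q.2.2.1 j
    · obtain ⟨n, hn⟩ := hcon q.1 q.2.2.1 q.2.2.2 h
      exact ⟨n, fun _ => hn⟩
    · exact ⟨0, fun h' => absurd h' h⟩
  choose nb hnb using hbad
  obtain ⟨K, hK⟩ := exists_polarized_pigeonhole J (ℕ × ℕ × (∀ j, V j) × C)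
  let cyl : ℕ → Finset (Σ j, K j) → (∀ j, K j → X j) → Set (∀ j, K j → X j) := fun l F x =>
    {y | ∀ e ∈ F, π e.1 l (y e.1 e.2) = π e.1 l (x e.1 e.2)}
  obtain ⟨𝒢, hcons, hdec⟩ := exists_deciding_family {B | ∃ l F x, B = cyl l F x}
    (by
      rintro _ ⟨l, F, x, rfl⟩
      exact ⟨x, fun _ _ => rfl⟩)
    (fun m (a : ∀ j, K j) y => κ fun j => π j m (y j (a j)))
  have hsel : ∀ a : ∀ j, K j, ∃ (l : ℕ) (F : Finset (Σ j, K j)) (x : ∀ j, K j → X j) (c : C)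
      (G : Set (∀ j, K j → X j)),
      (∀ j, (⟨j, a j⟩ : Σ j, K j) ∈ F) ∧ cyl l F x ⊆ G ∧ (G, a, c) ∈ 𝒢 := by
    intro a
    obtain ⟨_, ⟨l, F, x, rfl⟩, _, c, hc⟩ := hdec a (cyl 0 ∅ fun j _ => Classical.arbitrary _)
      ⟨0, ∅, fun j _ => Classical.arbitrary _, rfl⟩
    refine ⟨l, F ∪ Finset.univ.image fun j => ⟨j, a j⟩, x, c, cyl l F x, ?_, ?_, hc⟩
    · intro j
      exact Finset.mem_union_right _ (Finset.mem_image_of_mem _ (Finset.mem_univ j))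
    · exact fun y hy e he => hy e (Finset.mem_union_left _ he)
  choose lA FA xA cA GA hFA hGA h𝒢 using hsel
  let v : ℕ → ℕ := fun l => ∑ j, (hfin j l).toFinset.card + 1
  have hv : ∀ l, 0 < v l := fun l => Nat.succ_pos _
  have hvle : ∀ l j, (hfin j l).toFinset.card ≤ v l := fun l j =>
    (Finset.single_le_sum (f := fun j => (hfin j l).toFinset.card)
      (fun _ _ => Nat.zero_le _) (Finset.mem_univ j)).trans (Nat.le_succ _)
  choose Mb hMb using fun q : ℕ × ℕ × (∀ j, V j) × C =>
    exists_box_of_dense J (v q.1 ^ q.2.1) (v (nb q)) (pow_pos (hv _) _) (hv _)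
  obtain ⟨q, H, hH, hg⟩ := hK
    (fun a => (lA a, (FA a).card, (fun j => π j (lA a) (xA a j (a j))), cA a)) Mb
  have hdense := hMb q K H hH
  have hbadq := hnb q
  obtain ⟨n, hn⟩ : ∃ n, n = nb q := ⟨_, rfl⟩
  rw [← hn] at hdense hbadq
  obtain ⟨l, s, t, c⟩ := q
  simp only [Prod.mk.injEq] at hg hbadq hdense
  have : ∀ e : Σ j, K j, Fintype (Set.range (π e.1 l)) := fun e => (hfin e.1 l).fintype
  obtain ⟨y, hy⟩ := exists_assignment_of_partial (W := fun e : Σ j, K j => Set.range (π e.1 l))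
    (v l) s (hv l) (fun e => by
      refine le_trans (le_of_eq ?_) (hvle l e.1)
      rw [← Set.toFinset_card]
      congr 1
      ext
      simp) (Fintype.piFinset H) FA
    (fun a ha => (hg a (Fintype.mem_piFinset.1 ha)).2.1.le)
    (fun a e => ⟨π e.1 l (xA a e.1 e.2), Set.mem_range_self _⟩)
  obtain ⟨H', hH'H, hH'c, hP⟩ := hdense
    (fun a => ∀ e ∈ FA a, y e = ⟨π e.1 l (xA a e.1 e.2), Set.mem_range_self _⟩) (by
      rw [Fintype.card_piFinset, Finset.prod_congr rfl fun j _ => hH j] at hy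
      convert hy)
  have hH'ne : ∀ j, (H' j).Nonempty := fun j =>
    Finset.card_pos.1 (lt_of_lt_of_le (hv _) (hH'c j))
  choose a₀ ha₀ using hH'ne
  have hthrough : ∀ j, ∀ h ∈ H' j, ∃ a : ∀ j, K j, (∀ j, a j ∈ H' j) ∧ a j = h := by
    intro j h hh
    refine ⟨Function.update a₀ j h, fun i => ?_, by simp⟩
    by_cases hi : i = j
    · subst hi; simpa using hh
    · simpa [hi] using ha₀ i
  have hyt : ∀ j, ∀ h ∈ H' j, (y ⟨j, h⟩ : V j) = t j := by
    intro j h hh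
    obtain ⟨a, ha, rfl⟩ := hthrough j h hh
    obtain ⟨h1, _, h3, _⟩ := hg a fun j => hH'H j (ha j)
    rw [hP a ha ⟨j, a j⟩ (hFA a j), ← h3, h1]
  have htne : ∀ j, ∃ x : X j, π j l x = t j := fun j => by
    rw [← hyt j (a₀ j) (ha₀ j)]
    exact (y ⟨j, a₀ j⟩).2
  have hσ : ∀ j, ∃ σ : K j → X j, (∀ h, π j l (σ h) = t j) ∧
      ∀ x, π j l x = t j → ∃ h ∈ H' j, π j n (σ h) = π j n x := by
    intro j
    obtain ⟨x₀, hx₀⟩ := htne j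
    let R := (hfin j n).toFinset.filter fun u => ∃ x, π j l x = t j ∧ π j n x = u
    have hRc : R.card ≤ (H' j).card :=
      (Finset.card_filter_le _ _).trans ((hvle n j).trans (hn ▸ hH'c j))
    obtain ⟨f⟩ : Nonempty (R ↪ H' j) :=
      Function.Embedding.nonempty_of_card_le (by simpa using hRc)
    have hrep : ∀ u : R, ∃ x, π j l x = t j ∧ π j n x = u := fun u =>
      (Finset.mem_filter.1 u.2).2
    choose rep hrep₁ hrep₂ using hrep
    have hmem : ∀ x, π j l x = t j → π j n x ∈ R := fun x hx =>
      Finset.mem_filter.2 ⟨by simp, x, hx, rfl⟩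
    have : Nonempty R := ⟨⟨_, hmem x₀ hx₀⟩⟩
    refine ⟨fun h => if hh : h ∈ H' j then rep (Function.invFun f ⟨h, hh⟩) else x₀, ?_, ?_⟩
    · intro h
      by_cases hh : h ∈ H' j
      · simp [hh, hrep₁]
      · simp [hh, hx₀]
    · intro x hx
      refine ⟨f ⟨_, hmem x hx⟩, (f _).2, ?_⟩
      simp [Function.leftInverse_invFun f.injective _, hrep₂]
  choose σ hσl hσn using hσ
  let z : ∀ j, K j → X j := fun j h => if h ∈ H' j then σ j h else (y ⟨j, h⟩).2.choose
  have hzσ : ∀ j, ∀ h ∈ H' j, z j h = σ j h := fun j h hh => by simp [z, hh]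
  have hz : ∀ j h, π j l (z j h) = y ⟨j, h⟩ := by
    intro j h
    by_cases hh : h ∈ H' j
    · rw [hzσ j h hh, hσl, hyt j h hh]
    · simp only [z, hh, if_false]
      exact (y ⟨j, h⟩).2.choose_spec
  let U := (Fintype.piFinset H').biUnion FA
  have hGz : ∀ a : ∀ j, K j, (∀ j, a j ∈ H' j) → cyl (max l n) U z ⊆ GA a := by
    intro a ha
    refine fun w hw => hGA a fun e he => ?_
    have h1 := hw e (Finset.mem_biUnion.2 ⟨a, Fintype.mem_piFinset.2 ha, he⟩)
    have h2 := hP a ha e he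
    rw [(hg a fun j => hH'H j (ha j)).1, hπle _ _ _ (le_max_left l n) _ _ h1, hz]
    exact congrArg Subtype.val h2
  obtain ⟨m, hm, w, hw, hwc⟩ := hcons
    ((Fintype.piFinset H').image fun a => (GA a, a, cA a)) (by
      intro g hg
      obtain ⟨a, _, rfl⟩ := Finset.mem_image.1 hg
      exact h𝒢 a) (cyl (max l n) U z) ⟨_, _, _, rfl⟩ (by
      intro g hg
      obtain ⟨a, ha, rfl⟩ := Finset.mem_image.1 hg
      exact hGz a (Fintype.mem_piFinset.1 ha)) n
  have hκ : ∀ a : ∀ j, K j, (∀ j, a j ∈ H' j) → κ (fun j => π j m (w j (a j))) = c := by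
    intro a ha
    rw [← (hg a fun j => hH'H j (ha j)).2.2.2]
    exact hwc (GA a, a, cA a) (Finset.mem_image_of_mem _ (Fintype.mem_piFinset.2 ha))
  have hwn : ∀ j, ∀ h ∈ H' j, π j n (w j h) = π j n (σ j h) := by
    intro j h hh
    obtain ⟨a, ha, rfl⟩ := hthrough j h hh
    rw [← hzσ j _ hh]
    exact hπle _ _ _ (le_max_right l n) _ _
      (hw ⟨j, a j⟩ (Finset.mem_biUnion.2 ⟨a, Fintype.mem_piFinset.2 ha, hFA a j⟩))
  have hinv : ∀ j (u : V j), ∃ h ∈ H' j, (∃ x, π j l x = t j ∧ π j n x = u) →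
      π j n (σ j h) = u := by
    intro j u
    by_cases hu : ∃ x, π j l x = t j ∧ π j n x = u
    · obtain ⟨x, hx, rfl⟩ := hu
      obtain ⟨h, hh, he⟩ := hσn j x hx
      exact ⟨h, hh, fun _ => he⟩
    · exact ⟨a₀ j, ha₀ j, fun h => absurd h hu⟩
  choose inv hinv₁ hinv₂ using hinv
  choose x₀ hx₀ using htne
  obtain ⟨y', hy', hne⟩ := hbadq ⟨x₀, hx₀⟩ m hm (fun j u => w j (inv j u)) (fun j x hx => by
    rw [hwn _ _ (hinv₁ _ _)]
    exact hinv₂ _ _ ⟨x, hx, rfl⟩)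
  exact hne (hκ _ fun j => hinv₁ _ _)

/-- `ℓ` is the level function of a tree on `α` whose levels are finite and in which every node
has successors on all higher levels. -/
structure IsLevelFunction {α : Type*} [PartialOrder α] (ℓ : α → ℕ) : Prop where
  exists_le : ∀ t n, n ≤ ℓ t → ∃ s ≤ t, ℓ s = n
  strictMono : StrictMono ℓ
  le_or_le : ∀ s s' t : α, s ≤ t → s' ≤ t → s ≤ s' ∨ s' ≤ s
  exists_ge : ∀ t n, ℓ t ≤ n → ∃ s, t ≤ s ∧ ℓ s = n
  finite_level : ∀ n, {t | ℓ t = n}.Finite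

/-- `S` is (the underlying set of) a strong subtree with level set `A`, described in terms of the
level function `ℓ` of the ambient tree. -/
structure IsStrongSet {α : Type*} [PartialOrder α] (ℓ : α → ℕ) (A : Set ℕ) (S : Set α) : Prop where
  level_mem : ∀ s ∈ S, ℓ s ∈ A
  mem_of_le : ∀ s ∈ S, ∀ t ≤ s, ℓ t ∈ A → t ∈ S
  exists_meet : ∀ s ∈ S, ∀ s' ∈ S, ∃ m ∈ S, m ≤ s ∧ m ≤ s' ∧
    ∀ m', m' ≤ s → m' ≤ s' → m' ≤ m
  exists_succ : ∀ s ∈ S, ∀ t, s ≤ t → ℓ t = ℓ s + 1 → ∀ a ∈ A, ℓ s < a →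
    ∃ s' ∈ S, ℓ s' = a ∧ t ≤ s'
  nonempty : A.Nonempty → S.Nonempty

section LeveledTrees

variable {α : Type*} [PartialOrder α] {ℓ : α → ℕ} {A : Set ℕ} {S : Set α}

theorem IsLevelFunction.le_of_le (hT : IsLevelFunction ℓ) {s s' t : α} (h : s ≤ t) (h' : s' ≤ t)
    (hl : ℓ s ≤ ℓ s') : s ≤ s' := by
  rcases hT.le_or_le s s' t h h' with h1 | h1
  · exact h1
  · rcases h1.eq_or_lt with h2 | h2
    · exact h2.ge
    · exact absurd (hT.strictMono h2) (not_lt.2 hl)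

theorem IsLevelFunction.eq_of_le (hT : IsLevelFunction ℓ) {s s' t : α} (h : s ≤ t) (h' : s' ≤ t)
    (hl : ℓ s = ℓ s') : s = s' :=
  le_antisymm (hT.le_of_le h h' hl.le) (hT.le_of_le h' h hl.ge)

theorem IsStrongSet.exists_ge (hT : IsLevelFunction ℓ) (hS : IsStrongSet ℓ A S) {s : α}
    (hs : s ∈ S) {a : ℕ} (ha : a ∈ A) (hsa : ℓ s ≤ a) : ∃ s' ∈ S, ℓ s' = a ∧ s ≤ s' := by
  rcases hsa.eq_or_lt with h | h
  · exact ⟨s, hs, h, le_rfl⟩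
  · obtain ⟨t, hst, ht⟩ := hT.exists_ge s (ℓ s + 1) (Nat.le_succ _)
    obtain ⟨s', hs', hl, hts⟩ := hS.exists_succ s hs t hst ht a ha h
    exact ⟨s', hs', hl, hst.trans hts⟩

theorem IsStrongSet.exists_branch (hT : IsLevelFunction ℓ) (hS : IsStrongSet ℓ A S) {a : ℕ → ℕ}
    (hmono : StrictMono a) (haA : ∀ n, a n ∈ A) {s : α} (hs : s ∈ S) {n₀ : ℕ}
    (hsn : ℓ s = a n₀) :
    ∃ b : ℕ → α, (∀ n, b n ∈ S ∧ ℓ (b n) = a n ∧ b n ≤ b (n + 1)) ∧ b n₀ = s := by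
  have hsucc : ∀ (k : ℕ) (u : {u : α // u ∈ S ∧ ℓ u = a (n₀ + k)}),
      ∃ u' : {u : α // u ∈ S ∧ ℓ u = a (n₀ + (k + 1))}, u.1 ≤ u'.1 := by
    rintro k ⟨u, hu, hl⟩
    obtain ⟨u', hu', hl', hle⟩ := hS.exists_ge hT hu (haA (n₀ + (k + 1)))
      (hl ▸ hmono.monotone (by omega))
    exact ⟨⟨u', hu', hl'⟩, hle⟩
  choose f hf using hsucc
  let U : ∀ k, {u : α // u ∈ S ∧ ℓ u = a (n₀ + k)} := fun k =>
    Nat.rec ⟨s, hs, hsn⟩ f k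
  have hU : ∀ k, (U k).1 ≤ (U (k + 1)).1 := fun k => hf k (U k)
  have hUmono : Monotone fun k => (U k).1 := monotone_nat_of_le_succ hU
  have hres : ∀ n, ∃ t ≤ (U n).1, ℓ t = a n := fun n =>
    hT.exists_le _ _ ((hmono.monotone (Nat.le_add_left n n₀)).trans (U n).2.2.ge)
  choose b hb hbl using hres
  refine ⟨b, fun n => ⟨?_, hbl n, ?_⟩, ?_⟩
  · exact hS.mem_of_le _ (U n).2.1 _ (hb n) (hbl n ▸ haA n)
  · refine hT.le_of_le ((hb n).trans (hU n)) (hb (n + 1)) ?_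
    rw [hbl, hbl]
    exact hmono.monotone (Nat.le_succ n)
  · exact hT.eq_of_le (hb n₀) (hUmono (Nat.zero_le n₀)) ((hbl n₀).trans hsn.symm)

end LeveledTrees

/-- The strong form of the Halpern–Läuchli theorem. -/
theorem exists_strong_monochromatic (J : Type) [Finite J] {α : J → Type}
    [∀ j, PartialOrder (α j)] {ℓ : ∀ j, α j → ℕ} (hT : ∀ j, IsLevelFunction (ℓ j)) {A : Set ℕ}
    (hA : A.Infinite) {S : ∀ j, Set (α j)} (hS : ∀ j, IsStrongSet (ℓ j) A (S j))
    {C : Type} [Finite C] (κ : (∀ j, α j) → C) :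
    ∃ A' ⊆ A, A'.Infinite ∧ ∃ S' : ∀ j, Set (α j), (∀ j, S' j ⊆ S j) ∧
      (∀ j, IsStrongSet (ℓ j) A' (S' j)) ∧
      ∃ c, ∀ n ∈ A', ∀ z : ∀ j, α j, (∀ j, z j ∈ S' j ∧ ℓ j (z j) = n) → κ z = c := by
  obtain ⟨a, hmono, haA, hAa⟩ : ∃ a : ℕ → ℕ, StrictMono a ∧ (∀ n, a n ∈ A) ∧
      ∀ i ∈ A, ∃ n, a n = i :=
    ⟨Nat.nth (· ∈ A), Nat.nth_strictMono hA, fun n => Nat.nth_mem_of_infinite hA n, fun i hi =>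
      ⟨Nat.count (· ∈ A) i, Nat.nth_count hi⟩⟩
  let X : J → Type := fun j =>
    {b : ℕ → α j // ∀ n, b n ∈ S j ∧ ℓ j (b n) = a n ∧ b n ≤ b (n + 1)}
  have hbr : ∀ j, ∀ s ∈ S j, ∀ n, ℓ j s = a n → ∃ b : X j, b.1 n = s := by
    intro j s hs n hsn
    obtain ⟨b, hb, hbs⟩ := (hS j).exists_branch (hT j) hmono haA hs hsn
    exact ⟨⟨b, hb⟩, hbs⟩
  have hbmono : ∀ j (b : X j), Monotone b.1 := fun j b =>
    monotone_nat_of_le_succ fun n => (b.2 n).2.2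
  have hblev : ∀ j (b : X j) n, ℓ j (b.1 n) = a n := fun j b n => (b.2 n).2.1
  have hbelow : ∀ j (b : X j) k n u, b.1 n ≤ u → ∀ s ≤ u, ℓ j s = a k → k ≤ n → b.1 k = s := by
    intro j b k n u hu s hs hsk hkn
    exact (hT j).eq_of_le ((hbmono j b hkn).trans hu) hs ((hblev j b k).trans hsk.symm)
  have hagree : ∀ j (b b' : X j) k n, k ≤ n → b.1 n = b'.1 n → b.1 k = b'.1 k := by
    intro j b b' k n hkn h
    exact hbelow j b k n _ h.le _ (hbmono j b' hkn) (hblev j b' k) hkn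
  have : ∀ j, Nonempty (X j) := by
    intro j
    obtain ⟨s, hs⟩ := (hS j).nonempty hA.nonempty
    obtain ⟨n, hn⟩ := hAa _ ((hS j).level_mem s hs)
    exact ⟨(hbr j s hs n hn.symm).choose⟩
  obtain ⟨l, t, c, ⟨x, hx⟩, hd⟩ := exists_dense_monochromatic J X α (fun j n b => b.1 n)
    (fun j n => ((hT j).finite_level (a n)).subset (by rintro _ ⟨b, rfl⟩; exact hblev j b n))
    (fun j n b b' h => hagree j b b' n (n + 1) (Nat.le_succ n) h) κ
  choose M hM ψ hψ hκ using hd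
  let nn : ℕ → ℕ := fun p => Nat.rec l (fun _ n => M n + 1) p
  let mm : ℕ → ℕ := fun p => M (nn p)
  have hnn : ∀ p, nn (p + 1) = mm p + 1 := fun p => rfl
  have hnm : ∀ p, nn p ≤ mm p := fun p => hM _
  have hmm : StrictMono mm := strictMono_nat_of_lt_succ fun p =>
    lt_of_lt_of_le (Nat.lt_succ_self _) ((hnn p).ge.trans (hnm (p + 1)))
  have hln : ∀ p, l ≤ nn p := by
    intro p
    cases p with
    | zero => exact le_rfl
    | succ p => exact ((hM l).trans (hmm.monotone (Nat.zero_le p))).trans (hnn p ▸ Nat.le_succ _)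
  let Good : ∀ j, X j → ℕ → Prop := fun j y p =>
    y.1 l = t j ∧ ∀ q ≤ p, y.1 (mm q) = (ψ (nn q) j (y.1 (nn q))).1 (mm q)
  have hgood_agree : ∀ j (y y' : X j) p, y.1 (mm p) = y'.1 (mm p) → Good j y p → Good j y' p := by
    intro j y y' p h hy
    refine ⟨(hagree j y y' l (mm p) ((hln p).trans (hnm p)) h).symm.trans hy.1, fun q hq => ?_⟩
    have hle := hmm.monotone hq
    rw [← hagree j y y' _ _ hle h, ← hagree j y y' _ _ ((hnm q).trans hle) h]
    exact hy.2 q hq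
  have hstep : ∀ j (y : X j) p, Good j y p →
      ∃ y' : X j, Good j y' (p + 1) ∧ y'.1 (nn (p + 1)) = y.1 (nn (p + 1)) := by
    intro j y p hy
    have h1 := hψ (nn (p + 1)) j y hy.1
    refine ⟨ψ (nn (p + 1)) j (y.1 (nn (p + 1))), ?_, h1⟩
    have h2 : Good j (ψ (nn (p + 1)) j (y.1 (nn (p + 1)))) p :=
      hgood_agree j y _ p
        (hagree j _ _ _ _ (by rw [hnn]; exact Nat.le_succ _) h1.symm) hy
    refine ⟨h2.1, fun q hq => ?_⟩
    rcases Nat.le_succ_iff.1 hq with hq | rfl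
    · exact h2.2 q hq
    · simp only [Nat.succ_eq_add_one, h1]
  have hext : ∀ j (y : X j) p, Good j y p → ∀ q, p ≤ q →
      ∃ y' : X j, Good j y' q ∧ y'.1 (mm p) = y.1 (mm p) := by
    intro j y p hy q hpq
    induction q, hpq using Nat.le_induction with
    | base => exact ⟨y, hy, rfl⟩
    | succ q hpq ih =>
      obtain ⟨y', hy', h⟩ := ih
      obtain ⟨y'', hy'', h'⟩ := hstep j y' q hy'
      refine ⟨y'', hy'', (hagree j _ _ _ _ ?_ h').trans h⟩
      rw [hnn]
      exact (hmm.monotone hpq).trans (Nat.le_succ _)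
  have hamm : StrictMono fun p => a (mm p) := hmono.comp hmm
  refine ⟨Set.range fun p => a (mm p), ?_, Set.infinite_range_of_injective hamm.injective,
    fun j => {s | ∃ y p, Good j y p ∧ y.1 (mm p) = s}, ?_, fun j => ⟨?_, ?_, ?_, ?_, ?_⟩, c, ?_⟩
  · rintro _ ⟨p, rfl⟩
    exact haA _
  · rintro j _ ⟨y, p, _, rfl⟩
    exact (y.2 _).1
  · rintro _ ⟨y, p, _, rfl⟩
    exact ⟨p, (hblev j y _).symm⟩
  · rintro _ ⟨y, p, hy, rfl⟩ s hs ⟨q, hq⟩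
    have hqp : q ≤ p := by
      refine hamm.le_iff_le.1 ?_
      simp only at hq ⊢
      rw [hq, ← hblev j y]
      exact (hT j).strictMono.monotone hs
    exact ⟨y, q, ⟨hy.1, fun r hr => hy.2 r (hr.trans hqp)⟩,
      hbelow j y _ _ _ le_rfl s hs hq.symm (hmm.monotone hqp)⟩
  · have key : ∀ y p y' q, Good j y p → Good j y' q → p ≤ q →
        ∃ e ≤ p, y.1 (mm e) = y'.1 (mm e) ∧
          ∀ m', m' ≤ y.1 (mm p) → m' ≤ y'.1 (mm q) → m' ≤ y.1 (mm e) := by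
      intro y p y' q hy hy' hpq
      have hex : ∃ e, e ≤ p ∧ y.1 (mm e) = y'.1 (mm e) := by
        refine ⟨0, Nat.zero_le _, ?_⟩
        rw [hy.2 0 (Nat.zero_le _), hy'.2 0 (Nat.zero_le _)]
        change (ψ l j (y.1 l)).1 _ = (ψ l j (y'.1 l)).1 _
        rw [hy.1, hy'.1]
      let e := Nat.findGreatest (fun e => y.1 (mm e) = y'.1 (mm e)) p
      have he : y.1 (mm e) = y'.1 (mm e) := by
        obtain ⟨e₀, h1, h2⟩ := hex
        exact Nat.findGreatest_spec (P := fun e => y.1 (mm e) = y'.1 (mm e)) h1 h2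
      have hep : e ≤ p := Nat.findGreatest_le p
      refine ⟨e, hep, he, fun m' h1 h2 => ?_⟩
      rcases hep.eq_or_lt with hep' | hlt
      · rw [hep']; exact h1
      obtain ⟨m, hm, hms, hms', hmax⟩ := (hS j).exists_meet _ (y.2 (mm p)).1 _ (y'.2 (mm q)).1
      refine (hmax m' h1 h2).trans ?_
      obtain ⟨i, hi⟩ := hAa _ ((hS j).level_mem m hm)
      have hie : i ≤ mm e := by
        by_contra hcon
        have hni : nn (e + 1) ≤ i := by rw [hnn]; omega
        obtain ⟨w, hw, hwl⟩ := (hT j).exists_le m (a (nn (e + 1))) (hi ▸ hmono.monotone hni)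
        have hnp : nn (e + 1) ≤ mm p := (hnm _).trans (hmm.monotone hlt)
        have e1 := hbelow j y (nn (e + 1)) (mm p) _ le_rfl w (hw.trans hms) hwl hnp
        have e2 := hbelow j y' (nn (e + 1)) (mm q) _ le_rfl w (hw.trans hms') hwl
          (hnp.trans (hmm.monotone hpq))
        have : y.1 (mm (e + 1)) = y'.1 (mm (e + 1)) := by
          rw [hy.2 _ hlt, hy'.2 _ (le_trans hlt hpq), e1, e2]
        exact absurd this (Nat.findGreatest_is_greatest (P := fun e => y.1 (mm e) = y'.1 (mm e))
          (Nat.lt_succ_self e) hlt)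
      refine (hT j).le_of_le hms (hbmono j y (hmm.monotone hep)) ?_
      rw [hblev, ← hi]
      exact hmono.monotone hie
    rintro _ ⟨y, p, hy, rfl⟩ _ ⟨y', q, hy', rfl⟩
    rcases le_total p q with hpq | hpq
    · obtain ⟨e, hep, he, hmax⟩ := key y p y' q hy hy' hpq
      exact ⟨_, ⟨y, e, ⟨hy.1, fun r hr => hy.2 r (hr.trans hep)⟩, rfl⟩,
        hbmono j y (hmm.monotone hep), he ▸ hbmono j y' (hmm.monotone (hep.trans hpq)), hmax⟩
    · obtain ⟨e, hep, he, hmax⟩ := key y' q y p hy' hy hpq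
      exact ⟨_, ⟨y', e, ⟨hy'.1, fun r hr => hy'.2 r (hr.trans hep)⟩, rfl⟩,
        he ▸ hbmono j y (hmm.monotone (hep.trans hpq)), hbmono j y' (hmm.monotone hep),
        fun m' h1 h2 => hmax m' h2 h1⟩
  · rintro _ ⟨y, p, hy, rfl⟩ u hu hul _ ⟨q, rfl⟩ hpq
    rw [hblev] at hpq hul
    have hpq : p < q := hamm.lt_iff_lt.1 hpq
    obtain ⟨s₁, hs₁, hl₁, hus₁⟩ := (hS j).exists_succ _ (y.2 (mm p)).1 u hu (by rw [hul, hblev])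
      (a (nn (p + 1))) (haA _) (by rw [hblev, hnn]; exact hmono (Nat.lt_succ_self _))
    obtain ⟨y₁, hy₁⟩ := hbr j s₁ hs₁ _ hl₁
    have h1 : Good j y₁ p := by
      refine hgood_agree j y y₁ p ?_ hy
      refine ((hbelow j y₁ (mm p) (nn (p + 1)) s₁ hy₁.le _ (hu.trans hus₁) (hblev j y _) ?_)).symm
      rw [hnn]
      exact Nat.le_succ _
    obtain ⟨y₂, hy₂, h₂⟩ := hstep j y₁ p h1
    obtain ⟨y₃, hy₃, h₃⟩ := hext j y₂ (p + 1) hy₂ q hpq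
    refine ⟨_, ⟨y₃, q, hy₃, rfl⟩, hblev j y₃ _, hus₁.trans ?_⟩
    rw [← hy₁, ← h₂, ← hagree j _ _ _ _ (hnm (p + 1)) h₃]
    exact hbmono j y₃ ((hnm _).trans (hmm.monotone hpq))
  · intro _
    have h1 : (ψ l j (t j)).1 l = t j := by
      have := hψ l j (x j) (hx j)
      simpa only [hx j] using this
    refine ⟨_, ψ l j (t j), 0, ⟨h1, fun q hq => ?_⟩, rfl⟩
    obtain rfl : q = 0 := Nat.le_zero.1 hq
    change _ = (ψ l j ((ψ l j (t j)).1 l)).1 _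
    rw [h1]
  · rintro _ ⟨p, rfl⟩ z hz
    choose y q hy hyz using fun j => (hz j).1
    have hq : ∀ j, q j = p := fun j => hamm.injective (by
      have := (hz j).2
      rw [← hyz, hblev] at this
      exact this)
    have : z = fun j => (ψ (nn p) j ((y j).1 (nn p))).1 (mm p) := by
      funext j
      rw [← hyz j, (hy j).2 (q j) le_rfl, hq j]
    rw [this]
    exact hκ (nn p) y fun j => (hy j).1

section LeveledTrees

variable {α : Type*} [PartialOrder α] {ℓ : α → ℕ} {A : Set ℕ} {S : Set α}

theorem IsStrongSet.exists_level_eq (hT : IsLevelFunction ℓ) (hS : IsStrongSet ℓ A S) {a : ℕ}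
    (ha : a ∈ A) : ∃ s ∈ S, ℓ s = a := by
  obtain ⟨s, hs⟩ := hS.nonempty ⟨a, ha⟩
  rcases le_total a (ℓ s) with h | h
  · obtain ⟨t, hts, ht⟩ := hT.exists_le s a h
    exact ⟨t, hS.mem_of_le s hs t hts (ht ▸ ha), ht⟩
  · obtain ⟨t, ht, hl, _⟩ := hS.exists_ge hT hs ha h
    exact ⟨t, ht, hl⟩

theorem IsStrongSet.image_level (hT : IsLevelFunction ℓ) (hS : IsStrongSet ℓ A S) :
    ℓ '' S = A := by
  ext a
  constructor
  · rintro ⟨s, hs, rfl⟩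
    exact hS.level_mem s hs
  · exact fun ha => hS.exists_level_eq hT ha

/-- Two nodes of a strong set on the same level coincide if all levels of the set above a common
lower bound are at least the level of the nodes. -/
theorem IsStrongSet.eq_of_level_eq (hT : IsLevelFunction ℓ) (hS : IsStrongSet ℓ A S) {s s' : α}
    (hs : s ∈ S) (hs' : s' ∈ S) (hl : ℓ s = ℓ s')
    (h : ∀ m ∈ S, (∀ m', m' ≤ s → m' ≤ s' → m' ≤ m) → ℓ s ≤ ℓ m) : s = s' := by
  obtain ⟨m, hm, hms, hms', hmax⟩ := hS.exists_meet s hs s' hs'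
  have hlm := h m hm hmax
  rw [← hT.eq_of_le hms le_rfl (le_antisymm (hT.strictMono.monotone hms) hlm)]
  exact hT.eq_of_le hms' le_rfl (le_antisymm (hT.strictMono.monotone hms') (hl ▸ hlm))

theorem IsStrongSet.truncate (hT : IsLevelFunction ℓ) (hS : IsStrongSet ℓ A S) (N : ℕ) :
    IsStrongSet ℓ (A ∩ Set.Iic N) (S ∩ {s | ℓ s ≤ N}) where
  level_mem s hs := ⟨hS.level_mem s hs.1, hs.2⟩
  mem_of_le s hs t hts ht := ⟨hS.mem_of_le s hs.1 t hts ht.1, ht.2⟩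
  exists_meet s hs s' hs' := by
    obtain ⟨m, hm, hms, h⟩ := hS.exists_meet s hs.1 s' hs'.1
    exact ⟨m, ⟨hm, (hT.strictMono.monotone hms).trans hs.2⟩, hms, h⟩
  exists_succ s hs t hst ht a ha hsa := by
    obtain ⟨s', hs', hl, h⟩ := hS.exists_succ s hs.1 t hst ht a ha.1 hsa
    exact ⟨s', ⟨hs', hl.le.trans ha.2⟩, hl, h⟩
  nonempty := by
    rintro ⟨a, ha⟩
    obtain ⟨s, hs, hl⟩ := hS.exists_level_eq hT ha.1
    exact ⟨s, hs, hl.le.trans ha.2⟩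

theorem IsStrongSet.inter_Ici (hT : IsLevelFunction ℓ) (hS : IsStrongSet ℓ A S) {N : ℕ}
    {u s : α} (hu : ℓ u = N + 1) (hs : s ∈ S) (hsu : s ≤ u) (hsN : ℓ s = N) :
    IsStrongSet ℓ (A ∩ Set.Ioi N) (S ∩ Set.Ici u) where
  level_mem t ht := ⟨hS.level_mem t ht.1, by
    have := hT.strictMono.monotone (Set.mem_Ici.1 ht.2)
    rw [Set.mem_Ioi]
    omega⟩
  mem_of_le t ht v hvt hv := ⟨hS.mem_of_le t ht.1 v hvt hv.1,
    hT.le_of_le ht.2 hvt (hu ▸ Set.mem_Ioi.1 hv.2)⟩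
  exists_meet t ht t' ht' := by
    obtain ⟨m, hm, hms, hms', h⟩ := hS.exists_meet t ht.1 t' ht'.1
    exact ⟨m, ⟨hm, h u ht.2 ht'.2⟩, hms, hms', h⟩
  exists_succ t ht v htv hv a ha hta := by
    obtain ⟨t', ht', hl, h⟩ := hS.exists_succ t ht.1 v htv hv a ha.1 hta
    exact ⟨t', ⟨ht', le_trans ht.2 (htv.trans h)⟩, hl, h⟩
  nonempty := by
    rintro ⟨a, ha, haN⟩
    obtain ⟨t, ht, _, h⟩ := hS.exists_succ s hs u hsu (by rw [hu, hsN]) a ha (hsN ▸ haN)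
    exact ⟨t, ht, h⟩

end LeveledTrees

/-- The colour of a vector strong subtree of `S` with exactly one level above `N` and with `N`
among its levels depends only on its part up to level `N`. -/
def IsEndHomogeneousAt {ι : Type} {α : ι → Type} [∀ i, PartialOrder (α i)] (ℓ : ∀ i, α i → ℕ)
    {R : Type} (χ : (∀ i, Set (α i)) → R) (N : ℕ) (A : Set ℕ) (S : ∀ i, Set (α i)) : Prop :=
  ∃ f : (∀ i, Set (α i)) → R, ∀ B ⊆ A, N ∈ B → (∀ b ∈ B, b ≤ N) → ∀ a ∈ A, N < a →
    ∀ Y : ∀ i, Set (α i), (∀ i, Y i ⊆ S i) → (∀ i, IsStrongSet (ℓ i) (insert a B) (Y i)) →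
      χ Y = f fun i => Y i ∩ {s | ℓ i s ≤ N}

section Milliken

variable {ι : Type} {α : ι → Type} [∀ i, PartialOrder (α i)] {ℓ : ∀ i, α i → ℕ}
  {R : Type} {χ : (∀ i, Set (α i)) → R} {N : ℕ} {A : Set ℕ} {S : ∀ i, Set (α i)}

theorem IsEndHomogeneousAt.mono (h : IsEndHomogeneousAt ℓ χ N A S) {A' : Set ℕ}
    {S' : ∀ i, Set (α i)} (hA : A' ⊆ A) (hS : ∀ i, S' i ⊆ S i) :
    IsEndHomogeneousAt ℓ χ N A' S' := by
  obtain ⟨f, hf⟩ := h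
  exact ⟨f, fun B hB hN hle a ha hNa Y hY =>
    hf B (hB.trans hA) hN hle a (hA ha) hNa Y fun i => (hY i).trans (hS i)⟩

/-- A vector strong subtree can be thinned out above level `N` to become end-homogeneous at `N`. -/
theorem exists_endHomogeneousAt [Finite ι] [Finite R] (hT : ∀ i, IsLevelFunction (ℓ i))
    (χ : (∀ i, Set (α i)) → R) (hA : A.Infinite) (hS : ∀ i, IsStrongSet (ℓ i) A (S i))
    (hN : N ∈ A) :
    ∃ A' ⊆ A, A'.Infinite ∧ ∃ S' : ∀ i, Set (α i), (∀ i, S' i ⊆ S i) ∧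
      (∀ i, IsStrongSet (ℓ i) A' (S' i)) ∧ (∀ n ∈ A, n ≤ N → n ∈ A') ∧
      (∀ i, ∀ s ∈ S i, ℓ i s ≤ N → s ∈ S' i) ∧ IsEndHomogeneousAt ℓ χ N A' S' := by
  let U : ι → Type := fun i => {u : α i // ℓ i u = N + 1 ∧ ∃ s ∈ S i, s ≤ u ∧ ℓ i s = N}
  have : ∀ i, Finite (U i) := fun i =>
    Set.Finite.to_subtype (((hT i).finite_level (N + 1)).subset fun u hu => hu.1)
  have hlow : ∀ i, (S i ∩ {s | ℓ i s ≤ N}).Finite := by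
    intro i
    refine Set.Finite.subset ((Set.finite_Iic N).biUnion fun n _ => (hT i).finite_level n) ?_
    intro s hs
    simp only [Set.mem_iUnion]
    exact ⟨ℓ i s, hs.2, rfl⟩
  let Low := {X : ∀ i, Set (α i) // ∀ i, X i ∈ {Z | Z ⊆ S i ∩ {s | ℓ i s ≤ N}}}
  have : Finite Low := Set.Finite.to_subtype (Set.Finite.pi' fun i => (hlow i).finite_subsets)
  let E : (∀ i, Set (α i)) → (∀ j : Σ i, U i, α j.1) → ∀ i, Set (α i) := fun X z i =>
    X i ∪ {w | ∃ u : U i, z ⟨i, u⟩ = w ∧ ∃ s ∈ X i, ℓ i s = N ∧ s ≤ u.1}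
  obtain ⟨A', hA'A, hA', S', hS'S, hS', c, hc⟩ :=
    exists_strong_monochromatic (Σ i, U i) (α := fun j => α j.1) (ℓ := fun j => ℓ j.1)
      (fun j => hT j.1) (A := A ∩ Set.Ioi N)
      (by
        refine (hA.sdiff (Set.finite_Iic N)).mono fun n hn => ⟨hn.1, ?_⟩
        simpa using hn.2)
      (S := fun j => S j.1 ∩ Set.Ici j.2.1)
      (fun j => by
        obtain ⟨i, u, hu, s, hs, hsu, hsN⟩ := j
        exact (hS i).inter_Ici (hT i) hu hs hsu hsN)
      (fun z (X : Low) => χ (E X.1 z))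
  have hA'N : ∀ a ∈ A', N < a := fun a ha => (hA'A ha).2
  let A'' : Set ℕ := (A ∩ Set.Iic N) ∪ A'
  let S'' : ∀ i, Set (α i) := fun i => (S i ∩ {s | ℓ i s ≤ N}) ∪ ⋃ u : U i, S' ⟨i, u⟩
  have hhigh : ∀ i, ∀ s ∈ S'' i, N < ℓ i s → ∃ u : U i, s ∈ S' ⟨i, u⟩ := by
    rintro i s (hs | hs) hN
    · exact absurd hs.2 (not_le.2 hN)
    · exact Set.mem_iUnion.1 hs
  have hS''S : ∀ i, S'' i ⊆ S i := by
    rintro i s (hs | hs)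
    · exact hs.1
    · obtain ⟨u, hu⟩ := Set.mem_iUnion.1 hs
      exact (hS'S ⟨i, u⟩ hu).1
  have hA''A' : ∀ a ∈ A'', N < a → a ∈ A' := by
    rintro a (ha | ha) h
    · exact absurd ha.2 (not_le.2 h)
    · exact ha
  have hA''A : A'' ⊆ A := by
    rintro a (ha | ha)
    · exact ha.1
    · exact (hA'A ha).1
  have hUeq : ∀ i (u u' : U i) m, u.1 ≤ m → u'.1 ≤ m → u = u' := fun i u u' m h h' =>
    Subtype.ext ((hT i).eq_of_le h h' (u.2.1.trans u'.2.1.symm))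
  have hUle : ∀ i (u : U i), ∀ s ∈ S' ⟨i, u⟩, u.1 ≤ s := fun i u s hs => (hS'S ⟨i, u⟩ hs).2
  refine ⟨A'', hA''A, hA'.mono Set.subset_union_right, S'', hS''S, fun i => ⟨?_, ?_, ?_, ?_, ?_⟩,
    fun n hn hnN => Or.inl ⟨hn, hnN⟩, fun i s hs hl => Or.inl ⟨hs, hl⟩, ?_⟩
  · rintro s (hs | hs)
    · exact Or.inl ⟨(hS i).level_mem s hs.1, hs.2⟩
    · obtain ⟨u, hu⟩ := Set.mem_iUnion.1 hs
      exact Or.inr ((hS' ⟨i, u⟩).level_mem s hu)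
  · intro s hs t hts ht
    rcases le_or_gt (ℓ i t) N with h | h
    · exact Or.inl ⟨(hS i).mem_of_le s (hS''S i hs) t hts (hA''A ht), h⟩
    · obtain ⟨u, hu⟩ := hhigh i s hs (h.trans_le ((hT i).strictMono.monotone hts))
      exact Or.inr (Set.mem_iUnion.2 ⟨u, (hS' ⟨i, u⟩).mem_of_le s hu t hts (hA''A' _ ht h)⟩)
  · intro s hs s' hs'
    obtain ⟨m, hm, hms, hms', hmax⟩ := (hS i).exists_meet s (hS''S i hs) s' (hS''S i hs')
    rcases le_or_gt (ℓ i m) N with h | h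
    · exact ⟨m, Or.inl ⟨hm, h⟩, hms, hms', hmax⟩
    · obtain ⟨u, hu⟩ := hhigh i s hs (h.trans_le ((hT i).strictMono.monotone hms))
      obtain ⟨u', hu'⟩ := hhigh i s' hs' (h.trans_le ((hT i).strictMono.monotone hms'))
      obtain rfl := hUeq i u u' m
        ((hT i).le_of_le (hUle i u s hu) hms (u.2.1.le.trans h))
        ((hT i).le_of_le (hUle i u' s' hu') hms' (u'.2.1.le.trans h))
      obtain ⟨m', hm', h'⟩ := (hS' ⟨i, u⟩).exists_meet s hu s' hu'
      exact ⟨m', Or.inr (Set.mem_iUnion.2 ⟨u, hm'⟩), h'⟩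
  · intro s hs t hst ht a ha hsa
    rcases le_or_gt (ℓ i s) N with hsN | hsN
    · obtain ⟨s', hs', hl, hts'⟩ := (hS i).exists_succ s (hS''S i hs) t hst ht a (hA''A ha) hsa
      rcases le_or_gt a N with haN | haN
      · exact ⟨s', Or.inl ⟨hs', hl.le.trans haN⟩, hl, hts'⟩
      · obtain ⟨u, htu⟩ : ∃ u : U i, t ≤ u.1 := by
          rcases hsN.eq_or_lt with hsN | hsN
          · exact ⟨⟨t, by rw [ht, hsN], s, hS''S i hs, hst, hsN⟩, le_rfl⟩
          · obtain ⟨s₁, hs₁, hl₁, hts₁⟩ :=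
              (hS i).exists_succ s (hS''S i hs) t hst ht N hN hsN
            obtain ⟨u, hu, hul⟩ := (hT i).exists_ge s₁ (N + 1) (hl₁.le.trans (Nat.le_succ N))
            exact ⟨⟨u, hul, s₁, hs₁, hu, hl₁⟩, hts₁.trans hu⟩
        obtain ⟨w, hw, hwl⟩ := (hS' ⟨i, u⟩).exists_level_eq (hT i) (hA''A' a ha haN)
        exact ⟨w, Or.inr (Set.mem_iUnion.2 ⟨u, hw⟩), hwl, htu.trans (hUle i u w hw)⟩
    · obtain ⟨u, hu⟩ := hhigh i s hs hsN
      obtain ⟨w, hw, h⟩ := (hS' ⟨i, u⟩).exists_succ s hu t hst ht a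
        (hA''A' a ha (hsN.trans hsa)) hsa
      exact ⟨w, Or.inr (Set.mem_iUnion.2 ⟨u, hw⟩), h⟩
  · intro _
    obtain ⟨s, hs, hl⟩ := (hS i).exists_level_eq (hT i) hN
    exact ⟨s, Or.inl ⟨hs, hl.le⟩⟩
  refine ⟨fun X => if h : ∀ i, X i ∈ {Z | Z ⊆ S i ∩ {s | ℓ i s ≤ N}} then c ⟨X, h⟩ else χ X, ?_⟩
  intro B hB hNB hBle a ha hNa Y hYS hY
  have hYlow : ∀ i, Y i ∩ {s | ℓ i s ≤ N} ∈ {Z | Z ⊆ S i ∩ {s | ℓ i s ≤ N}} := fun i s hs =>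
    ⟨hS''S i (hYS i hs.1), hs.2⟩
  refine Eq.trans ?_ (dif_pos hYlow).symm
  have haA' := hA''A' a ha hNa
  have hYlev : ∀ i, ∀ y ∈ Y i, N < ℓ i y → ℓ i y = a := by
    intro i y hy hNy
    rcases (hY i).level_mem y hy with h | h
    · exact h
    · exact absurd (hBle _ h) (not_le.2 hNy)
  have hYuniq : ∀ i (u y y' : α i), ℓ i u = N + 1 → y ∈ Y i → y' ∈ Y i → u ≤ y → u ≤ y' →
      y = y' := by
    intro i u y y' hu hy hy' huy huy'
    have hl : ∀ w ∈ Y i, u ≤ w → ℓ i w = a := fun w hw huw => hYlev i w hw (by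
      have := (hT i).strictMono.monotone huw
      omega)
    refine (hY i).eq_of_level_eq (hT i) hy hy' ((hl y hy huy).trans (hl y' hy' huy').symm) ?_
    intro m hm hmax
    rw [hl y hy huy, hl m hm (hmax u huy huy')]
  have hz : ∀ j : Σ i, U i, ∃ w : α j.1, (w ∈ S' j ∧ ℓ j.1 w = a) ∧
      ((∃ s ∈ Y j.1, ℓ j.1 s = N ∧ s ≤ j.2.1) → w ∈ Y j.1) := by
    rintro ⟨i, u⟩
    by_cases h : ∃ s ∈ Y i, ℓ i s = N ∧ s ≤ u.1
    · obtain ⟨s, hs, hsN, hsu⟩ := h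
      obtain ⟨w, hw, hwl, huw⟩ := (hY i).exists_succ s hs u.1 hsu (by rw [u.2.1, hsN]) a
        (Set.mem_insert _ _) (hsN ▸ hNa)
      obtain ⟨u', hu'⟩ := hhigh i w (hYS i hw) (hwl ▸ hNa)
      obtain rfl := hUeq i u u' w huw (hUle i u' w hu')
      exact ⟨w, ⟨hu', hwl⟩, fun _ => hw⟩
    · obtain ⟨w, hw, hwl⟩ := (hS' ⟨i, u⟩).exists_level_eq (hT i) haA'
      exact ⟨w, ⟨hw, hwl⟩, fun h' => absurd h' h⟩
  choose z hz hzY using hz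
  have hEY : E (fun i => Y i ∩ {s | ℓ i s ≤ N}) z = Y := by
    funext i
    ext y
    constructor
    · rintro (hy | ⟨u, rfl, s, hs, hsN, hsu⟩)
      · exact hy.1
      · exact hzY ⟨i, u⟩ ⟨s, hs.1, hsN, hsu⟩
    · intro hy
      rcases le_or_gt (ℓ i y) N with hyN | hyN
      · exact Or.inl ⟨hy, hyN⟩
      · obtain ⟨s, hsy, hsN⟩ := (hT i).exists_le y N hyN.le
        obtain ⟨u, huy, huN⟩ := (hT i).exists_le y (N + 1) hyN
        have hsY : s ∈ Y i := (hY i).mem_of_le y hy s hsy (Or.inr (hsN ▸ hNB))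
        have hsu : s ≤ u := (hT i).le_of_le hsy huy (by omega)
        let u' : U i := ⟨u, huN, s, hS''S i (hYS i hsY), hsu, hsN⟩
        refine Or.inr ⟨u', ?_, s, ⟨hsY, hsN.le⟩, hsN, hsu⟩
        exact hYuniq i u _ _ huN (hzY ⟨i, u'⟩ ⟨s, hsY, hsN, hsu⟩) hy
          (hUle i u' _ (hz ⟨i, u'⟩).1) huy
  have := congrFun (hc a haA' z hz) ⟨_, hYlow⟩
  simp only [hEY] at this
  exact this

/-- Every vector strong subtree contains one that is end-homogeneous at all levels. -/
theorem exists_endHomogeneous [Finite ι] [Finite R] (hT : ∀ i, IsLevelFunction (ℓ i))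
    (χ : (∀ i, Set (α i)) → R) (hA : A.Infinite) (hS : ∀ i, IsStrongSet (ℓ i) A (S i)) :
    ∃ A' ⊆ A, A'.Infinite ∧ ∃ S' : ∀ i, Set (α i), (∀ i, S' i ⊆ S i) ∧
      (∀ i, IsStrongSet (ℓ i) A' (S' i)) ∧ ∀ N, IsEndHomogeneousAt ℓ χ N A' S' := by
  let P := {p : Set ℕ × (∀ i, Set (α i)) // p.1.Infinite ∧ ∀ i, IsStrongSet (ℓ i) p.1 (p.2 i)}
  have hstep : ∀ (N : ℕ) (p : P), ∃ p' : P, p'.1.1 ⊆ p.1.1 ∧ (∀ i, p'.1.2 i ⊆ p.1.2 i) ∧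
      (∀ n ∈ p.1.1, n ≤ N → n ∈ p'.1.1) ∧ (∀ i, ∀ s ∈ p.1.2 i, ℓ i s ≤ N → s ∈ p'.1.2 i) ∧
      (N ∉ p.1.1 → p' = p) ∧ IsEndHomogeneousAt ℓ χ N p'.1.1 p'.1.2 := by
    intro N p
    by_cases hN : N ∈ p.1.1
    · obtain ⟨A', h1, h2, S', h3, h4, h5, h6, h7⟩ := exists_endHomogeneousAt hT χ p.2.1 p.2.2 hN
      exact ⟨⟨(A', S'), h2, h4⟩, h1, h3, h5, h6, fun h => absurd hN h, h7⟩
    · exact ⟨p, subset_rfl, fun _ => subset_rfl, fun _ h _ => h, fun _ _ h _ => h, fun _ => rfl,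
        χ, fun B hB hNB => absurd (hB hNB) hN⟩
  choose next hnA hnS hkA hkS hsame hend using hstep
  let p : ℕ → P := fun n => Nat.rec ⟨(A, S), hA, hS⟩ next n
  have hp : ∀ n, p (n + 1) = next n (p n) := fun n => rfl
  have hantiA : Antitone fun n => (p n).1.1 := antitone_nat_of_succ_le fun n => hnA n (p n)
  have hantiS : ∀ i, Antitone fun n => (p n).1.2 i := fun i =>
    antitone_nat_of_succ_le fun n => hnS n (p n) i
  have hkeepA : ∀ N, ∀ a ∈ (p N).1.1, a ≤ N → a ∈ ⋂ n, (p n).1.1 := by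
    intro N a ha haN
    refine Set.mem_iInter.2 fun n => ?_
    rcases le_total n N with h | h
    · exact hantiA h ha
    · induction n, h using Nat.le_induction with
      | base => exact ha
      | succ n hn ih => exact hkA n (p n) a ih (haN.trans hn)
  have hkeepS : ∀ i N, ∀ s ∈ (p N).1.2 i, ℓ i s ≤ N → s ∈ ⋂ n, (p n).1.2 i := by
    intro i N s hs hsN
    refine Set.mem_iInter.2 fun n => ?_
    rcases le_total n N with h | h
    · exact hantiS i h hs
    · induction n, h using Nat.le_induction with
      | base => exact hs
      | succ n hn ih => exact hkS n (p n) i s ih (hsN.trans hn)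
  refine ⟨⋂ n, (p n).1.1, Set.iInter_subset _ 0, ?_, fun i => ⋂ n, (p n).1.2 i,
    fun i => Set.iInter_subset _ 0, fun i => ⟨?_, ?_, ?_, ?_, ?_⟩, fun N =>
      (hend N (p N)).mono (Set.iInter_subset _ (N + 1)) fun i => Set.iInter_subset _ (N + 1)⟩
  · refine Set.infinite_of_not_bddAbove ?_
    rintro ⟨b, hb⟩
    have hex : ∃ k, b + 1 + k ∈ (p (b + 1)).1.1 := by
      obtain ⟨a, ha, hba⟩ := (p (b + 1)).2.1.exists_gt b
      exact ⟨a - (b + 1), by rwa [Nat.add_sub_cancel' hba]⟩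
    have hconst : ∀ k ≤ Nat.find hex, p (b + 1 + k) = p (b + 1) := by
      intro k
      induction k with
      | zero => exact fun _ => rfl
      | succ k ih =>
        intro hk
        have h1 := ih (Nat.le_of_succ_le hk)
        have h2 := hsame (b + 1 + k) (p (b + 1 + k)) (by
          rw [h1]
          exact Nat.find_min hex hk)
        exact h2.trans h1
    have := hb (hkeepA (b + 1 + Nat.find hex) _ (by
      rw [hconst _ le_rfl]
      exact Nat.find_spec hex) le_rfl)
    omega
  · intro s hs
    exact Set.mem_iInter.2 fun n => ((p n).2.2 i).level_mem s (Set.mem_iInter.1 hs n)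
  · intro s hs t hts ht
    exact Set.mem_iInter.2 fun n =>
      ((p n).2.2 i).mem_of_le s (Set.mem_iInter.1 hs n) t hts (Set.mem_iInter.1 ht n)
  · intro s hs s' hs'
    obtain ⟨m, hm, hms, h⟩ := ((p (ℓ i s)).2.2 i).exists_meet s (Set.mem_iInter.1 hs _) s'
      (Set.mem_iInter.1 hs' _)
    exact ⟨m, hkeepS i _ m hm ((hT i).strictMono.monotone hms), hms, h⟩
  · intro s hs t hst ht a ha hsa
    obtain ⟨s', hs', hl, h⟩ := ((p a).2.2 i).exists_succ s (Set.mem_iInter.1 hs _) t hst ht a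
      (Set.mem_iInter.1 ha _) hsa
    exact ⟨s', hkeepS i _ s' hs' hl.le, hl, h⟩
  · rintro ⟨a, ha⟩
    obtain ⟨s, hs, hl⟩ := ((p a).2.2 i).exists_level_eq (hT i) (Set.mem_iInter.1 ha _)
    exact ⟨s, hkeepS i _ s hs hl.le⟩

/-- Milliken's theorem for strong sets in finitely many leveled trees. -/
theorem exists_strong_homogeneous [Finite ι] [Nonempty ι] [Finite R]
    (hT : ∀ i, IsLevelFunction (ℓ i)) (k : ℕ) (χ : (∀ i, Set (α i)) → R) (hA : A.Infinite)
    (hS : ∀ i, IsStrongSet (ℓ i) A (S i)) :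
    ∃ A' ⊆ A, A'.Infinite ∧ ∃ S' : ∀ i, Set (α i), (∀ i, S' i ⊆ S i) ∧
      (∀ i, IsStrongSet (ℓ i) A' (S' i)) ∧ ∃ c, ∀ B : Finset ℕ, B.card = k → ↑B ⊆ A' →
        ∀ X : ∀ i, Set (α i), (∀ i, X i ⊆ S' i) → (∀ i, IsStrongSet (ℓ i) (↑B) (X i)) →
          χ X = c := by
  induction k generalizing χ A S with
  | zero =>
    refine ⟨A, subset_rfl, hA, S, fun _ => subset_rfl, hS, χ fun _ => ∅, ?_⟩
    intro B hB _ X _ hX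
    obtain rfl := Finset.card_eq_zero.1 hB
    congr 1
    funext i
    exact Set.eq_empty_of_forall_notMem fun s hs => by simpa using (hX i).level_mem s hs
  | succ k ih =>
    rcases Nat.eq_zero_or_pos k with rfl | hk
    · obtain ⟨A', hA'A, hA', S', hS'S, hS', c, hc⟩ :=
        exists_strong_monochromatic ι hT hA hS fun z => χ fun i => {z i}
      refine ⟨A', hA'A, hA', S', hS'S, hS', c, ?_⟩
      intro B hB hBA X hXS hX
      obtain ⟨n, rfl⟩ := Finset.card_eq_one.1 hB
      have hlev : ∀ i, ∀ s ∈ X i, ℓ i s = n := fun i s hs => by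
        simpa using (hX i).level_mem s hs
      choose z hz using fun i => (hX i).nonempty ⟨n, by simp⟩
      rw [← hc n (hBA (by simp)) z fun i => ⟨hXS i (hz i), hlev i _ (hz i)⟩]
      congr 1
      funext i
      refine Set.eq_singleton_iff_unique_mem.2 ⟨hz i, fun s hs => ?_⟩
      refine (hX i).eq_of_level_eq (hT i) hs (hz i) ?_ fun m hm _ => ?_
      · rw [hlev i s hs, hlev i _ (hz i)]
      · rw [hlev i s hs, hlev i m hm]
    · obtain ⟨A₁, hA₁A, hA₁, S₁, hS₁S, hS₁, hend⟩ := exists_endHomogeneous hT χ hA hS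
      choose f hf using hend
      let i₀ : ι := Classical.arbitrary ι
      obtain ⟨A', hA'A, hA', S', hS'S, hS', c, hc⟩ :=
        ih (fun X => f (sSup (ℓ i₀ '' X i₀)) X) hA₁ hS₁
      refine ⟨A', hA'A.trans hA₁A, hA', S', fun i => (hS'S i).trans (hS₁S i), hS', c, ?_⟩
      intro B hB hBA Y hYS hY
      have hBne : B.Nonempty := Finset.card_pos.1 (by omega)
      let a := B.max' hBne
      have haB : a ∈ B := B.max'_mem hBne
      have hB₁ : (B.erase a).card = k := by rw [Finset.card_erase_of_mem haB, hB]; rfl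
      have hB₁ne : (B.erase a).Nonempty := Finset.card_pos.1 (by omega)
      let N := (B.erase a).max' hB₁ne
      have hNB : N ∈ B.erase a := (B.erase a).max'_mem hB₁ne
      have hNa : N < a := lt_of_le_of_ne (B.le_max' _ (Finset.mem_of_mem_erase hNB))
        (Finset.ne_of_mem_erase hNB)
      have hle : ∀ b ∈ (↑(B.erase a) : Set ℕ), b ≤ N := fun b hb => Finset.le_max' _ b hb
      have hins : insert a (↑(B.erase a) : Set ℕ) = ↑B := by
        rw [← Finset.coe_insert, Finset.insert_erase haB]
      have hcut : (↑B : Set ℕ) ∩ Set.Iic N = ↑(B.erase a) := by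
        ext b
        constructor
        · rintro ⟨hb, hbN⟩
          exact Finset.mem_coe.2 (Finset.mem_erase.2 ⟨(lt_of_le_of_lt hbN hNa).ne, hb⟩)
        · exact fun hb => ⟨Finset.mem_of_mem_erase hb, hle b hb⟩
      have hX : ∀ i, IsStrongSet (ℓ i) (↑(B.erase a)) (Y i ∩ {s | ℓ i s ≤ N}) := fun i =>
        hcut ▸ (hY i).truncate (hT i) N
      have hsub : (↑(B.erase a) : Set ℕ) ⊆ A' := fun b hb => hBA (Finset.mem_of_mem_erase hb)
      rw [hf N _ (hsub.trans hA'A) hNB hle a (hA'A (hBA haB)) hNa Y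
        (fun i => (hYS i).trans (hS'S i)) (fun i => by rw [hins]; exact hY i)]
      have hsup : sSup (ℓ i₀ '' (Y i₀ ∩ {s | ℓ i₀ s ≤ N})) = N := by
        rw [(hX i₀).image_level (hT i₀)]
        exact IsGreatest.csSup_eq ⟨hNB, hle⟩
      have := hc _ hB₁ hsub (fun i => Y i ∩ {s | ℓ i s ≤ N})
        (fun i => Set.inter_subset_left.trans (hYS i)) hX
      simp only [hsup] at this
      exact this

end Milliken

section TreeLevels

variable {α : Type*} [PartialOrder α] {U : Set α}

theorem IsTreeOn.mono (hU : IsTreeOn U) {V : Set α} (hV : V ⊆ U) : IsTreeOn V := by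
  have hsub : ∀ t, predsIn V t ⊆ predsIn U t := fun t s hs => ⟨hV hs.1, hs.2⟩
  intro t ht
  obtain ⟨h1, h2⟩ := hU t (hV ht)
  exact ⟨h1.subset (hsub t), fun s₁ h₁ s₂ h₂ => h2 s₁ (hsub t h₁) s₂ (hsub t h₂)⟩

theorem IsTreeOn.le_or_le (hU : IsTreeOn U) {s s' t : α} (hs : s ∈ U) (hs' : s' ∈ U)
    (ht : t ∈ U) (h : s ≤ t) (h' : s' ≤ t) : s ≤ s' ∨ s' ≤ s := by
  rcases h.eq_or_lt with rfl | h
  · exact Or.inr h'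
  rcases h'.eq_or_lt with rfl | h'
  · exact Or.inl h.le
  exact (hU t ht).2 s ⟨hs, h⟩ s' ⟨hs', h'⟩

theorem IsTreeOn.levelIn_lt (hU : IsTreeOn U) {s t : α} (hs : s ∈ U) (ht : t ∈ U) (h : s < t) :
    levelIn U s < levelIn U t := by
  refine Set.ncard_lt_ncard ?_ (hU t ht).1
  have hsub : predsIn U s ⊆ predsIn U t := fun u hu => ⟨hu.1, hu.2.trans h⟩
  refine (Set.ssubset_iff_of_subset hsub).2 ⟨s, ⟨hs, h⟩, ?_⟩
  exact fun hss => lt_irrefl s hss.2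

theorem IsTreeOn.le_of_levelIn_le (hU : IsTreeOn U) {s s' t : α} (hs : s ∈ U) (hs' : s' ∈ U)
    (ht : t ∈ U) (h : s ≤ t) (h' : s' ≤ t) (hl : levelIn U s ≤ levelIn U s') : s ≤ s' := by
  rcases hU.le_or_le hs hs' ht h h' with h1 | h1
  · exact h1
  · rcases h1.eq_or_lt with h2 | h2
    · exact h2.ge
    · exact absurd (hU.levelIn_lt hs' hs h2) (not_lt.2 hl)

theorem IsTreeOn.exists_le_levelIn_eq (hU : IsTreeOn U) {t : α} (ht : t ∈ U) {n : ℕ}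
    (hn : n ≤ levelIn U t) : ∃ s ∈ U, s ≤ t ∧ levelIn U s = n := by
  rcases hn.eq_or_lt with rfl | hn
  · exact ⟨t, ht, le_rfl, rfl⟩
  have hinj : Set.InjOn (levelIn U) (predsIn U t) := fun s hs s' hs' h =>
    le_antisymm (hU.le_of_levelIn_le hs.1 hs'.1 ht hs.2.le hs'.2.le h.le)
      (hU.le_of_levelIn_le hs'.1 hs.1 ht hs'.2.le hs.2.le h.ge)
  have himg : levelIn U '' predsIn U t = Set.Iio (levelIn U t) := by
    refine Set.eq_of_subset_of_ncard_le ?_ ?_ (Set.finite_Iio _)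
    · rintro _ ⟨s, hs, rfl⟩
      exact hU.levelIn_lt hs.1 ht hs.2
    · rw [hinj.ncard_image, ← Finset.coe_Iio, Set.ncard_coe_finset, Nat.card_Iio]
      exact le_rfl
  obtain ⟨s, hs, hsn⟩ := himg.ge hn
  exact ⟨s, hs.1, hs.2.le, hsn⟩

theorem IsTreeOn.isImmSuccIn_iff (hU : IsTreeOn U) {s t : α} (hs : s ∈ U) (ht : t ∈ U) :
    IsImmSuccIn U s t ↔ s < t ∧ levelIn U t = levelIn U s + 1 := by
  constructor
  · rintro ⟨_, _, hst, hbtw⟩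
    refine ⟨hst, ?_⟩
    obtain ⟨u, hu, hut, hul⟩ := hU.exists_le_levelIn_eq ht (hU.levelIn_lt hs ht hst)
    have hsu : s < u := by
      refine lt_of_le_of_ne (hU.le_of_levelIn_le hs hu ht hst.le hut ?_) ?_
      · rw [hul]; exact Nat.le_succ _
      · rintro rfl
        exact absurd hul (Nat.lt_succ_self _).ne
    rcases hut.eq_or_lt with rfl | hut
    · exact hul
    · exact absurd hut (hbtw u hu hsu)
  · rintro ⟨hst, hl⟩
    refine ⟨hs, ht, hst, fun u hu hsu hut => ?_⟩
    have h1 := hU.levelIn_lt hs hu hsu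
    have h2 := hU.levelIn_lt hu ht hut
    omega

theorem IsTreeOn.exists_ge_levelIn_eq (hU : IsTreeOn U) {t : α} (ht : t ∈ U) {n : ℕ}
    (hmax : ∀ s, IsMaximalIn U s → n ≤ levelIn U s) (hn : levelIn U t ≤ n) :
    ∃ s ∈ U, t ≤ s ∧ levelIn U s = n := by
  induction n, hn using Nat.le_induction with
  | base => exact ⟨t, ht, le_rfl, rfl⟩
  | succ n _ ih =>
    obtain ⟨s, hs, hts, hsn⟩ := ih fun s hs => Nat.le_of_succ_le (hmax s hs)
    have hnot : ¬ IsMaximalIn U s := fun h => absurd (hmax s h) (by omega)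
    obtain ⟨u, hu, hsu⟩ : ∃ u ∈ U, s < u := by
      simpa [IsMaximalIn, hs] using hnot
    obtain ⟨w, hw, hwu, hwl⟩ := hU.exists_le_levelIn_eq hu (hU.levelIn_lt hs hu hsu)
    refine ⟨w, hw, hts.trans (hU.le_of_levelIn_le hs hw hu hsu.le hwu ?_), by rw [hwl, hsn]⟩
    rw [hwl]
    exact Nat.le_succ _

theorem IsTreeOn.image_levelIn (hU : IsTreeOn U) {k : ℕ} (hk : heightIn U = k) :
    levelIn U '' U = Set.Iio k := by
  have hle : ∀ n : ℕ, (n : ℕ∞) < k ↔ ∃ t ∈ U, n ≤ levelIn U t := by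
    intro n
    rw [← hk, heightIn]
    simp only [lt_iSup_iff, ENat.lt_add_one_iff (ENat.natCast_ne_top _), Nat.cast_le, exists_prop]
  ext n
  constructor
  · rintro ⟨t, ht, rfl⟩
    exact Nat.cast_lt.1 ((hle _).2 ⟨t, ht, le_rfl⟩)
  · intro hn
    obtain ⟨t, ht, hnt⟩ := (hle n).1 (Nat.cast_lt.2 hn)
    obtain ⟨s, hs, _, h⟩ := hU.exists_le_levelIn_eq ht hnt
    exact ⟨s, hs, h⟩

theorem isLevelFunction_levelIn (hT : IsTreeOn (Set.univ : Set α))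
    (hroot : IsRootedIn (Set.univ : Set α)) (hfb : IsFinBranching (Set.univ : Set α))
    (hmax : ∀ t, ¬ IsMaximalIn (Set.univ : Set α) t) :
    IsLevelFunction (levelIn (Set.univ : Set α)) where
  exists_le t n hn := by
    obtain ⟨s, _, h⟩ := hT.exists_le_levelIn_eq (Set.mem_univ t) hn
    exact ⟨s, h⟩
  strictMono s t h := hT.levelIn_lt trivial trivial h
  le_or_le s s' t h h' := hT.le_or_le trivial trivial trivial h h'
  exists_ge t n hn := by
    obtain ⟨s, _, h⟩ := hT.exists_ge_levelIn_eq (Set.mem_univ t) (fun s hs => absurd hs (hmax s)) hn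
    exact ⟨s, h⟩
  finite_level n := by
    induction n with
    | zero =>
      obtain ⟨r, _, hr⟩ := hroot
      refine (Set.finite_singleton r).subset fun t ht => ?_
      rcases (hr t trivial).eq_or_lt with h | h
      · exact h.symm
      · have h1 := hT.levelIn_lt trivial trivial h
        have h2 : levelIn Set.univ t = 0 := ht
        omega
    | succ n ih =>
      refine (ih.biUnion fun s _ => hfb s trivial).subset fun t ht => ?_
      have ht : levelIn Set.univ t = n + 1 := ht
      obtain ⟨s, _, hst, hsn⟩ := hT.exists_le_levelIn_eq (Set.mem_univ t) ((Nat.le_succ n).trans ht.ge)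
      simp only [Set.mem_iUnion]
      refine ⟨s, hsn, (hT.isImmSuccIn_iff trivial trivial).2 ⟨lt_of_le_of_ne hst ?_, by omega⟩⟩
      rintro rfl
      omega

theorem isStrongSet_univ {ℓ : α → ℕ} (hℓ : IsLevelFunction ℓ) (hT : IsTreeOn (Set.univ : Set α))
    (hroot : IsRootedIn (Set.univ : Set α)) : IsStrongSet ℓ Set.univ Set.univ where
  level_mem _ _ := trivial
  mem_of_le _ _ _ _ _ := trivial
  exists_meet s _ s' _ := by
    obtain ⟨r, _, hr⟩ := hroot
    have hfin : {m | m ≤ s ∧ m ≤ s'}.Finite := by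
      refine ((hT s trivial).1.insert s).subset fun m hm => ?_
      rcases hm.1.eq_or_lt with h | h
      · exact Or.inl h
      · exact Or.inr ⟨trivial, h⟩
    obtain ⟨m, hm, hmax⟩ := Set.exists_max_image _ ℓ hfin ⟨r, hr s trivial, hr s' trivial⟩
    exact ⟨m, trivial, hm.1, hm.2, fun m' h h' => hℓ.le_of_le h hm.1 (hmax m' ⟨h, h'⟩)⟩
  exists_succ s _ t _ ht a _ hsa := by
    obtain ⟨u, htu, hu⟩ := hℓ.exists_ge t a (ht ▸ hsa)
    exact ⟨u, trivial, hu, htu⟩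
  nonempty _ := ⟨hroot.choose, trivial⟩

end TreeLevels

section Translation

variable {α : Type*} [PartialOrder α] {A : Set ℕ} {S : Set α}

theorem IsStrongSet.levelIn_eq_count {ℓ : α → ℕ} (hℓ : IsLevelFunction ℓ)
    (hS : IsStrongSet ℓ A S) {s : α} (hs : s ∈ S) : levelIn S s = Nat.count (· ∈ A) (ℓ s) := by
  have hinj : Set.InjOn ℓ (predsIn S s) := fun t ht t' ht' h => hℓ.eq_of_le ht.2.le ht'.2.le h
  rw [levelIn, ← hinj.ncard_image, Nat.count_eq_card_filter_range,
    ← Set.ncard_coe_finset]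
  congr 1
  ext a
  simp only [Finset.coe_filter, Finset.mem_range, Set.mem_ofPred_eq]
  constructor
  · rintro ⟨t, ht, rfl⟩
    exact ⟨hℓ.strictMono ht.2, hS.level_mem t ht.1⟩
  · rintro ⟨hlt, ha⟩
    obtain ⟨t, hts, rfl⟩ := hℓ.exists_le s a hlt.le
    refine ⟨t, ⟨hS.mem_of_le s hs t hts ha, lt_of_le_of_ne hts ?_⟩, rfl⟩
    rintro rfl
    exact lt_irrefl _ hlt

theorem injOn_count_mem (A : Set ℕ) : Set.InjOn (Nat.count (· ∈ A)) A := fun _ ha _ hb h =>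
  Nat.count_injective ha hb h

theorem IsStrongSet.level_eq_of_levelIn_eq {ℓ : α → ℕ} (hℓ : IsLevelFunction ℓ)
    (hS : IsStrongSet ℓ A S) {s t : α} (hs : s ∈ S) (ht : t ∈ S)
    (h : levelIn S s = levelIn S t) : ℓ s = ℓ t := by
  rw [hS.levelIn_eq_count hℓ hs, hS.levelIn_eq_count hℓ ht] at h
  exact Nat.count_injective (hS.level_mem s hs) (hS.level_mem t ht) h

/-- In a strong set, a non-maximal node has exactly one immediate successor above each of its
immediate successors in the ambient tree. -/
theorem IsStrongSet.existsUnique_isImmSuccIn {ℓ : α → ℕ} (hℓ : IsLevelFunction ℓ)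
    (hS : IsStrongSet ℓ A S) {s t : α} (hs : s ∈ S) (hst : s ≤ t) (ht : ℓ t = ℓ s + 1)
    (hA : ∃ a ∈ A, ℓ s < a) : ∃! c, IsImmSuccIn S s c ∧ t ≤ c := by
  have hmin : ∀ b ∈ A, ℓ s < b → Nat.find hA ≤ b := fun b hb h => Nat.find_min' hA ⟨hb, h⟩
  obtain ⟨haA, hsa⟩ := Nat.find_spec hA
  obtain ⟨c, hc, hcl, htc⟩ := hS.exists_succ s hs t hst ht _ haA hsa
  have hlt : ∀ u, t ≤ u → s < u := fun u hu => by
    refine lt_of_le_of_ne (hst.trans hu) ?_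
    rintro rfl
    have := hℓ.strictMono.monotone hu
    omega
  refine ⟨c, ⟨⟨hs, hc, hlt c htc, fun u hu hsu huc => ?_⟩, htc⟩, ?_⟩
  · have h1 := hmin _ (hS.level_mem u hu) (hℓ.strictMono hsu)
    have h2 := hℓ.strictMono huc
    omega
  · rintro c' ⟨⟨_, hc', hsc', hbtw⟩, htc'⟩
    have h1 := hmin _ (hS.level_mem c' hc') (hℓ.strictMono hsc')
    have hcl' : ℓ c' = Nat.find hA := by
      obtain ⟨u, huc', hul⟩ := hℓ.exists_le c' _ h1
      have huS : u ∈ S := hS.mem_of_le c' hc' u huc' (hul ▸ haA)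
      have htu : t ≤ u := hℓ.le_of_le htc' huc' (by omega)
      rcases huc'.eq_or_lt with rfl | h
      · exact hul
      · exact absurd h (hbtw u huS (hlt u htu))
    refine hS.eq_of_level_eq hℓ hc' hc (hcl'.trans hcl.symm) fun m hm hmax => ?_
    rw [hcl']
    exact hmin _ (hS.level_mem m hm) (hℓ.strictMono (hlt m (hmax t htc' htc)))

theorem IsStrongSet.heightIn_eq_top {ℓ : α → ℕ} (hℓ : IsLevelFunction ℓ)
    (hS : IsStrongSet ℓ A S) (hA : A.Infinite) : heightIn S = ⊤ := by
  refine ENat.eq_top_iff_forall_gt.2 fun n => ?_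
  obtain ⟨s, hs, hsl⟩ := hS.exists_level_eq hℓ (Nat.nth_mem_of_infinite (p := (· ∈ A)) hA n)
  have hn : levelIn S s = n := by
    rw [hS.levelIn_eq_count hℓ hs, hsl, Nat.count_nth_of_infinite (p := (· ∈ A)) hA]
  refine lt_of_lt_of_le ?_ (le_iSup₂ (f := fun t (_ : t ∈ S) => (levelIn S t : ℕ∞) + 1) s hs)
  rw [hn]
  exact_mod_cast Nat.lt_succ_self n

theorem IsStrongSet.isStrongSubtreeOf (hℓ : IsLevelFunction (levelIn (Set.univ : Set α)))
    (hT : IsTreeOn (Set.univ : Set α))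
    (hS : IsStrongSet (levelIn Set.univ) A S) (hA : A.Infinite) :
    IsStrongSubtreeOf Set.univ S := by
  refine ⟨⟨Set.subset_univ S, fun s hs t ht => ?_⟩, Or.inr ⟨?_, ?_, ?_, ?_⟩⟩
  · obtain ⟨m, hm, hms, hmt, hmax⟩ := hS.exists_meet s hs t ht
    exact ⟨m, hm, trivial, hms, hmt, fun m' _ => hmax m'⟩
  · obtain ⟨r, hr, hrl⟩ := hS.exists_level_eq hℓ (Nat.sInf_mem hA.nonempty)
    refine ⟨r, hr, fun t ht => ?_⟩
    obtain ⟨m, hm, hmr, hmt, _⟩ := hS.exists_meet r hr t ht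
    have : r ≤ m := hℓ.le_of_le le_rfl hmr (hrl ▸ Nat.sInf_le (hS.level_mem m hm))
    exact this.trans hmt
  · refine Or.inl ⟨hS.heightIn_eq_top hℓ hA, fun t ht => ?_⟩
    obtain ⟨a, ha, hta⟩ := hA.exists_gt (levelIn Set.univ t)
    obtain ⟨s, hs, hsl, hts⟩ := hS.exists_ge hℓ ht.1 ha hta.le
    refine ht.2 s hs (lt_of_le_of_ne hts ?_)
    rintro rfl
    omega
  · exact fun s hs t ht h => hS.level_eq_of_levelIn_eq hℓ hs ht h
  · intro s hs _ t ht
    obtain ⟨hst, hl⟩ := (hT.isImmSuccIn_iff trivial trivial).1 ht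
    obtain ⟨a, ha, hsa⟩ := hA.exists_gt (levelIn Set.univ s)
    exact hS.existsUnique_isImmSuccIn hℓ hs hst.le hl ⟨a, ha, hsa⟩

/-- A strong subtree, of finite height, of a strong set is a strong set. -/
theorem IsStrongSet.of_isStrongSubtreeOf {ℓ : α → ℕ} (hℓ : IsLevelFunction ℓ)
    (hT : IsTreeOn (Set.univ : Set α)) (hS : IsStrongSet ℓ A S) {X : Set α}
    (hX : IsStrongSubtreeOf S X) (hfin : heightIn X ≠ ⊤) : IsStrongSet ℓ (ℓ '' X) X := by
  obtain ⟨⟨hXS, hmeet⟩, rfl | ⟨_, hbal, hlev, hsucc⟩⟩ := hX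
  · exact ⟨by simp, by simp, by simp, by simp, by simp⟩
  have hXT : IsTreeOn X := hT.mono (Set.subset_univ X)
  have heq : ∀ s ∈ X, ∀ t ∈ X, levelIn X s = levelIn X t → ℓ s = ℓ t := fun s hs t ht h =>
    hS.level_eq_of_levelIn_eq hℓ (hXS hs) (hXS ht) (hlev s hs t ht h)
  have hlt : ∀ s ∈ X, ∀ t ∈ X, levelIn X s < levelIn X t → ℓ s < ℓ t := by
    intro s hs t ht h
    obtain ⟨u, hu, hut, hul⟩ := hXT.exists_le_levelIn_eq ht h.le
    rw [← heq u hu s hs hul]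
    refine hℓ.strictMono (lt_of_le_of_ne hut ?_)
    rintro rfl
    omega
  have hmaximal : ∀ y ∈ X, ∀ s, IsMaximalIn X s → levelIn X y ≤ levelIn X s := by
    intro y hy s hs
    rcases hbal with h | h
    · exact absurd h.1 hfin
    · have h1 : (levelIn X y : ℕ∞) + 1 ≤ heightIn X :=
        le_iSup₂ (f := fun t (_ : t ∈ X) => (levelIn X t : ℕ∞) + 1) y hy
      rw [← h.2 s hs] at h1
      have h2 : levelIn X y + 1 ≤ levelIn X s + 1 := by exact_mod_cast h1
      omega
  refine ⟨fun s hs => ⟨s, hs, rfl⟩, ?_, ?_, ?_, fun h => h.of_image⟩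
  · rintro s hs t hts ⟨y, hy, hyt⟩
    have hle : levelIn X y ≤ levelIn X s := by
      by_contra hcon
      have h1 := hlt s hs y hy (not_le.1 hcon)
      have h2 := hℓ.strictMono.monotone hts
      omega
    obtain ⟨u, hu, hus, hul⟩ := hXT.exists_le_levelIn_eq hs hle
    rw [hℓ.eq_of_le hts hus (hyt.symm.trans (heq u hu y hy hul).symm)]
    exact hu
  · intro s hs s' hs'
    obtain ⟨m, hm, _, hms, hms', hmax⟩ := hmeet s hs s' hs'
    obtain ⟨m₀, hm₀, h1, h2, h3⟩ := hS.exists_meet s (hXS hs) s' (hXS hs')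
    exact ⟨m, hm, hms, hms', fun m' h h' => (h3 m' h h').trans (hmax m₀ hm₀ h1 h2)⟩
  · rintro s hs t hst ht _ ⟨y, hy, rfl⟩ hsy
    have hsy' : levelIn X s < levelIn X y := by
      rcases lt_trichotomy (levelIn X s) (levelIn X y) with h | h | h
      · exact h
      · exact absurd (heq s hs y hy h) hsy.ne
      · exact absurd (hlt y hy s hs h) hsy.asymm
    obtain ⟨t', ⟨ht', htt'⟩, _⟩ := hS.existsUnique_isImmSuccIn hℓ (hXS hs) hst ht
      ⟨ℓ y, hS.level_mem y (hXS hy), hsy⟩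
    obtain ⟨c, ⟨hc, ht'c⟩, _⟩ := hsucc s hs
      (fun h => absurd (hmaximal y hy s h) (not_le.2 hsy')) t' ht'
    have hcl := ((hXT.isImmSuccIn_iff hs hc.2.1).1 hc).2
    obtain ⟨w, hw, hcw, hwl⟩ := hXT.exists_ge_levelIn_eq hc.2.1 (hmaximal y hy)
      (hcl ▸ hsy')
    exact ⟨w, hw, heq w hw y hy hwl, htt'.trans (ht'c.trans hcw)⟩

theorem IsStrongSet.levelSetIn_eq {ℓ : α → ℕ} (hℓ : IsLevelFunction ℓ)
    (hS : IsStrongSet ℓ A S) {X : Set α} (hX : X ⊆ S) :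
    levelSetIn S X = Nat.count (· ∈ A) '' (ℓ '' X) := by
  rw [levelSetIn, Set.image_image]
  exact Set.image_congr fun s hs => hS.levelIn_eq_count hℓ (hX hs)

theorem IsStrongSet.exists_finset_of_heightIn {ℓ : α → ℕ} (hℓ : IsLevelFunction ℓ)
    (hT : IsTreeOn (Set.univ : Set α)) (hS : IsStrongSet ℓ A S) {k : ℕ} (hk : heightIn S = k) :
    ∃ B : Finset ℕ, B.card = k ∧ ↑B = A := by
  have himg : Nat.count (· ∈ A) '' A = Set.Iio k := by
    have h := (hT.mono (Set.subset_univ S)).image_levelIn hk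
    rwa [← levelSetIn, hS.levelSetIn_eq hℓ subset_rfl, hS.image_level hℓ] at h
  have hfin : A.Finite :=
    Set.Finite.of_finite_image (himg ▸ Set.finite_Iio k) (injOn_count_mem A)
  refine ⟨hfin.toFinset, ?_, hfin.coe_toFinset⟩
  rw [← Set.ncard_eq_toFinset_card A hfin, ← (injOn_count_mem A).ncard_image, himg,
    ← Finset.coe_Iio, Set.ncard_coe_finset, Nat.card_Iio]

end Translation

/-- Milliken's vector (product) tree theorem: if `T = (T₁, …, T_d)` is a vector tree in
which every tree is nonempty, rooted, balanced, finitely branching and of infinite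
height, then for every `k` and every finite colouring of the vector strong subtrees of
`T` of height `k` there is an infinite-height vector strong subtree `S` of `T` such that
all vector strong subtrees of `S` of height `k` get the same colour. -/
theorem milliken_vector_tree_theorem (d : ℕ) (α : Fin d → Type) [∀ i, PartialOrder (α i)]
    (htree : ∀ i, IsTreeOn (Set.univ : Set (α i)))
    (hne : ∀ i, (Set.univ : Set (α i)).Nonempty)
    (hroot : ∀ i, IsRootedIn (Set.univ : Set (α i)))
    (hbal : ∀ i, IsBalanced (Set.univ : Set (α i)))
    (hfb : ∀ i, IsFinBranching (Set.univ : Set (α i)))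
    (hht : ∀ i, heightIn (Set.univ : Set (α i)) = ⊤)
    (k r : ℕ) (χ : (∀ i, Set (α i)) → Fin r) :
    ∃ S : ∀ i, Set (α i),
      (∀ i, IsStrongSubtreeOf (Set.univ : Set (α i)) (S i)) ∧
      (∀ i j, levelSetIn (Set.univ : Set (α i)) (S i)
        = levelSetIn (Set.univ : Set (α j)) (S j)) ∧
      (∀ i, heightIn (S i) = ⊤) ∧
      ∃ c : Fin r, ∀ X : ∀ i, Set (α i),
        (∀ i, IsStrongSubtreeOf (S i) (X i)) →
        (∀ i j, levelSetIn (S i) (X i) = levelSetIn (S j) (X j)) →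
        (∀ i, heightIn (X i) = (k : ℕ∞)) →
        χ X = c := by
  rcases isEmpty_or_nonempty (Fin d) with hd | hd
  · exact ⟨fun i => hd.elim i, fun i => hd.elim i, fun i => hd.elim i, fun i => hd.elim i,
      χ fun i => hd.elim i, fun X _ _ _ => congrArg χ (Subsingleton.elim _ _)⟩
  have hmax : ∀ i t, ¬ IsMaximalIn (Set.univ : Set (α i)) t := fun i =>
    (hbal i).elim (fun h => h.2) fun h => absurd (hht i) h.1
  have hℓ : ∀ i, IsLevelFunction (levelIn (Set.univ : Set (α i))) := fun i =>
    isLevelFunction_levelIn (htree i) (hroot i) (hfb i) (hmax i)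
  obtain ⟨A, _, hA, S, _, hS, c, hc⟩ := exists_strong_homogeneous hℓ k χ Set.infinite_univ
    fun i => isStrongSet_univ (hℓ i) (htree i) (hroot i)
  refine ⟨S, fun i => (hS i).isStrongSubtreeOf (hℓ i) (htree i) hA,
    fun i j => ((hS i).image_level (hℓ i)).trans ((hS j).image_level (hℓ j)).symm,
    fun i => (hS i).heightIn_eq_top (hℓ i) hA, c, fun X hX hlev hk => ?_⟩
  have hXS : ∀ i, X i ⊆ S i := fun i => (hX i).1.1
  have hXs : ∀ i, IsStrongSet (levelIn Set.univ) (levelIn Set.univ '' X i) (X i) := fun i =>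
    (hS i).of_isStrongSubtreeOf (hℓ i) (htree i) (hX i) (by rw [hk i]; exact ENat.natCast_ne_top k)
  have hsub : ∀ i, levelIn Set.univ '' X i ⊆ A := by
    rintro i _ ⟨s, hs, rfl⟩
    exact (hS i).level_mem s (hXS i hs)
  obtain ⟨i₀⟩ := hd
  obtain ⟨B, hBk, hB⟩ := (hXs i₀).exists_finset_of_heightIn (hℓ i₀) (htree i₀) (hk i₀)
  refine hc B hBk (hB ▸ hsub i₀) X hXS fun i => ?_
  have heq : levelIn Set.univ '' X i = levelIn Set.univ '' X i₀ := by
    refine (injOn_count_mem A).image_eq_image_iff (hsub i) (hsub i₀) |>.1 ?_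
    rw [← (hS i).levelSetIn_eq (hℓ i) (hXS i), ← (hS i₀).levelSetIn_eq (hℓ i₀) (hXS i₀)]
    exact hlev i i₀
  rw [hB, ← heq]
  exact hXs i
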